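/- arXiv:2203.03470 — 2 statements merged into one kernel-verified Lean document; each statement's English description precedes it below -/
import Mathlib

section
/- For every x₀ ∈ C there is a residual subset 𝓕 of the metric space (𝓜, ρ) such that every F ∈ 𝓕 admits a regular trajectory (x_k)_{k≥0} starting at x₀ — a sequence with x_0 = x₀ and P_{F(x_k)}(x_k) = {x_{k+1}} a singleton for all k — and this sequence converges in X to a point x* with x* ∈ F(x*), i.e. to a fixed point of F. -/
open Metric Set TopologicalSpace BoundedContinuousFunction Filter

/-- The metric projection of `x` onto the set `M`. -/
def projSet {X : Type*} [NormedAddCommGroup X] (M : Set X) (x : X) : Set X :=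
  {y ∈ M | dist x y = Metric.infDist x M}

/-- The space `𝓜` of nonexpansive compact-set-valued self-mappings of `C`, realized
inside the bounded continuous functions `C →ᵇ 𝒦(X)` (every nonexpansive map on the
bounded set `C` is bounded and continuous); the induced metric is the metric `ρ` of
uniform convergence of the Pompeiu–Hausdorff distances. -/
def MSet {X : Type*} [NormedAddCommGroup X] (C : Set X) :
    Set (C →ᵇ TopologicalSpace.NonemptyCompacts X) :=
  {F | (∀ x : C, (F x : Set X) ⊆ C) ∧ ∀ x y : C, dist (F x) (F y) ≤ dist (x : X) (y : X)}

section helpers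
variable {X : Type*} [NormedAddCommGroup X] [NormedSpace ℝ X]

/-- radial profile -/
noncomputable def prof (K r t : ℝ) : ℝ := max 0 (min t (K * (t - r)))

lemma prof_nonneg (K r t : ℝ) : 0 ≤ prof K r t := le_max_left _ _

lemma prof_le (K r : ℝ) {t : ℝ} (ht : 0 ≤ t) : prof K r t ≤ t :=
  max_le ht (min_le_left _ _)

lemma prof_eq_zero {K r t : ℝ} (hK : 0 ≤ K) (h : t ≤ r) : prof K r t = 0 := by
  unfold prof
  apply max_eq_left
  exact (min_le_right _ _).trans (mul_nonpos_of_nonneg_of_nonpos hK (by linarith))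

lemma prof_le_mul {K r t : ℝ} (hK : 0 ≤ K) (h : r ≤ t) : prof K r t ≤ K * (t - r) :=
  max_le (mul_nonneg hK (by linarith)) (min_le_right _ _)

lemma prof_star {K r s t : ℝ} (hK : 0 ≤ K) (hr : 0 ≤ r) (hs : 0 ≤ s) (hst : s ≤ t) :
    prof K r s * t ≤ prof K r t * s := by
  have ht : 0 ≤ t := hs.trans hst
  unfold prof
  rw [max_mul_of_nonneg _ _ ht, max_mul_of_nonneg _ _ hs, min_mul_of_nonneg _ _ ht,
    min_mul_of_nonneg _ _ hs]
  apply max_le_max (by simp)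
  apply min_le_min
  · rw [mul_comm]
  · have := mul_nonneg (mul_nonneg hK hr) (sub_nonneg.2 hst)
    nlinarith

lemma prof_lip {K r s t : ℝ} (hK : 1 ≤ K) (hst : s ≤ t) :
    prof K r t - prof K r s ≤ K * (t - s) := by
  unfold prof
  have h0 : 0 ≤ K * (t - s) := mul_nonneg (by linarith) (by linarith)
  have h1 : t - s ≤ K * (t - s) := by nlinarith
  rw [sub_le_iff_le_add]
  apply max_le
  · have := le_max_left 0 (min s (K * (s - r)))
    linarith
  · have := le_max_right 0 (min s (K * (s - r)))
    rcases le_total s (K * (s - r)) with h | h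
    · rw [min_eq_left h] at *
      have := min_le_left t (K * (t - r))
      linarith
    · rw [min_eq_right h] at *
      have := min_le_right t (K * (t - r))
      nlinarith

/-- radial contraction towards `q` -/
noncomputable def pt (K r : ℝ) (q p : X) : X := q + (prof K r ‖p - q‖ / ‖p - q‖) • (p - q)

lemma pt_dist_center (K r : ℝ) (q p : X) : dist (pt K r q p) q = prof K r (dist p q) := by
  rw [dist_eq_norm, dist_eq_norm, pt, add_sub_cancel_left, norm_smul, Real.norm_eq_abs,
    abs_of_nonneg (div_nonneg (prof_nonneg _ _ _) (norm_nonneg _))]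
  by_cases h : ‖p - q‖ = 0
  · have := prof_le K r (norm_nonneg (p - q))
    have := prof_nonneg K r (‖p - q‖)
    rw [h] at *; simp; linarith
  · field_simp

lemma pt_coef (K r : ℝ) (q p : X) : 0 ≤ prof K r ‖p - q‖ / ‖p - q‖ ∧
    prof K r ‖p - q‖ / ‖p - q‖ ≤ 1 :=
  ⟨div_nonneg (prof_nonneg _ _ _) (norm_nonneg _),
    div_le_one_of_le₀ (prof_le K r (norm_nonneg _)) (norm_nonneg _)⟩

lemma pt_mem {C : Set X} (hC : Convex ℝ C) (K r : ℝ) {q p : X} (hq : q ∈ C) (hp : p ∈ C) :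
    pt K r q p ∈ C :=
  hC.add_smul_sub_mem hq hp ⟨(pt_coef K r q p).1, (pt_coef K r q p).2⟩

lemma pt_move (K r : ℝ) (q p : X) : dist (pt K r q p) p = dist p q - prof K r (dist p q) := by
  have h1 : pt K r q p - p = -((1 - prof K r ‖p - q‖ / ‖p - q‖) • (p - q)) := by
    rw [pt]; module
  rw [dist_eq_norm, h1, norm_neg, norm_smul, Real.norm_eq_abs,
    abs_of_nonneg (by linarith [(pt_coef K r q p).2]), dist_eq_norm]
  by_cases h : ‖p - q‖ = 0
  · have := prof_le K r (norm_nonneg (p - q))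
    have := prof_nonneg K r (‖p - q‖)
    rw [h] at *; simp; linarith
  · field_simp

lemma pt_lip {K r : ℝ} (hK : 1 ≤ K) (hr : 0 ≤ r) (q p p' : X) :
    dist (pt K r q p) (pt K r q p') ≤ K * dist p p' := by
  wlog h : ‖p' - q‖ ≤ ‖p - q‖ generalizing p p'
  · rw [dist_comm, dist_comm p p']
    exact this p' p (le_of_not_ge h)
  set u := p - q with hu
  set v := p' - q with hv
  have e1 : pt K r q p - pt K r q p' = (prof K r ‖u‖ / ‖u‖) • (u - v) +
      (prof K r ‖u‖ / ‖u‖ - prof K r ‖v‖ / ‖v‖) • v := by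
    rw [pt, pt, ← hu, ← hv]; module
  have e2 : p - p' = u - v := by rw [hu, hv]; abel
  rw [dist_eq_norm, dist_eq_norm, e1, e2]
  have hg0 := (pt_coef K r q p).1
  have hg1 := (pt_coef K r q p).2
  rw [← hu] at hg0 hg1
  by_cases hv0 : ‖v‖ = 0
  · have : v = 0 := norm_eq_zero.1 hv0
    rw [this]; simp only [smul_zero, add_zero]
    rw [norm_smul, Real.norm_eq_abs, abs_of_nonneg hg0]
    apply mul_le_mul_of_nonneg_right (hg1.trans hK) (norm_nonneg _)
  have hvp : 0 < ‖v‖ := lt_of_le_of_ne (norm_nonneg _) (Ne.symm hv0)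
  have hup : 0 < ‖u‖ := lt_of_lt_of_le hvp h
  have hst := prof_star (K := K) (r := r) (by linarith) hr (norm_nonneg v) h
  have hmono : prof K r ‖v‖ / ‖v‖ ≤ prof K r ‖u‖ / ‖u‖ := by
    rw [div_le_div_iff₀ hvp hup]; exact hst
  have hl := prof_lip (r := r) hK h
  have f1 : prof K r ‖u‖ / ‖u‖ * ‖u‖ = prof K r ‖u‖ := by field_simp
  have f2 : prof K r ‖v‖ / ‖v‖ * ‖v‖ = prof K r ‖v‖ := by field_simp
  have ht : ‖u‖ - ‖v‖ ≤ ‖u - v‖ := norm_sub_norm_le u v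
  calc _ ≤ _ := norm_add_le _ _
    _ = prof K r ‖u‖ / ‖u‖ * ‖u - v‖ + (prof K r ‖u‖ / ‖u‖ - prof K r ‖v‖ / ‖v‖) * ‖v‖ := by
      rw [norm_smul, norm_smul, Real.norm_eq_abs, Real.norm_eq_abs, abs_of_nonneg hg0,
        abs_of_nonneg (by linarith)]
    _ ≤ _ := by
      generalize prof K r ‖u‖ / ‖u‖ = g at *
      generalize prof K r ‖v‖ / ‖v‖ = g' at *
      nlinarith

lemma pt_continuous {K r : ℝ} (hK : 1 ≤ K) (hr : 0 ≤ r) (q : X) : Continuous (pt K r q) := by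
  have : LipschitzWith (Real.toNNReal K) (pt K r q) := by
    apply LipschitzWith.of_dist_le_mul
    intro x y
    rw [Real.coe_toNNReal K (by linarith)]
    exact pt_lip hK hr q x y
  exact this.continuous

/-- contraction-type set-valued map on `C` -/
def Good (C : Set X) (L : ℝ) (F : X → Set X) : Prop :=
  ∀ x ∈ C, IsCompact (F x) ∧ (F x).Nonempty ∧ F x ⊆ C ∧
    ∀ y ∈ C, ∀ p ∈ F x, ∃ q ∈ F y, dist p q ≤ L * dist x y

/-- uniform closeness -/
def Near (C : Set X) (ε : ℝ) (F G : X → Set X) : Prop :=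
  ∀ x ∈ C, (∀ p ∈ F x, ∃ q ∈ G x, dist p q ≤ ε) ∧ (∀ q ∈ G x, ∃ p ∈ F x, dist p q ≤ ε)

lemma Near.trans {C : Set X} {ε ε' : ℝ} {F G H : X → Set X} (h : Near C ε F G)
    (h' : Near C ε' G H) : Near C (ε + ε') F H := by
  intro x hx
  constructor
  · intro p hp
    obtain ⟨q, hq, h1⟩ := (h x hx).1 p hp
    obtain ⟨z, hz, h2⟩ := (h' x hx).1 q hq
    exact ⟨z, hz, (dist_triangle p q z).trans (by linarith)⟩
  · intro p hp
    obtain ⟨q, hq, h1⟩ := (h' x hx).2 p hp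
    obtain ⟨z, hz, h2⟩ := (h x hx).2 q hq
    exact ⟨z, hz, (dist_triangle z q p).trans (by linarith)⟩

lemma Near.mono {C : Set X} {ε ε' : ℝ} {F G : X → Set X} (h : Near C ε F G) (he : ε ≤ ε') :
    Near C ε' F G := by
  intro x hx
  refine ⟨fun p hp => ?_, fun p hp => ?_⟩
  · obtain ⟨q, hq, h1⟩ := (h x hx).1 p hp
    exact ⟨q, hq, h1.trans he⟩
  · obtain ⟨q, hq, h1⟩ := (h x hx).2 p hp
    exact ⟨q, hq, h1.trans he⟩

lemma good_contract {C : Set X} (hC : Convex ℝ C) {F : X → Set X} (hF : Good C 1 F) {D : ℝ}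
    (hD0 : 0 ≤ D) (hD : ∀ x ∈ C, ∀ y ∈ C, dist x y ≤ D) {ε : ℝ} (hε : 0 < ε) {x₀ : X}
    (hx₀ : x₀ ∈ C) : ∃ L : ℝ, 0 ≤ L ∧ L < 1 ∧ ∃ F', Good C L F' ∧ Near C ε F F' := by
  obtain ⟨t, ht0, ht1, htD⟩ : ∃ t : ℝ, 0 < t ∧ t ≤ 1 ∧ t * D ≤ ε := by
    refine ⟨min 1 (ε / (D + 1)), lt_min one_pos (by positivity), min_le_left _ _, ?_⟩
    calc _ ≤ ε / (D + 1) * D := mul_le_mul_of_nonneg_right (min_le_right _ _) hD0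
      _ ≤ ε := by
        rw [div_mul_eq_mul_div, div_le_iff₀ (by positivity)]; nlinarith
  have key : ∀ p q : X, dist (p + t • (x₀ - p)) (q + t • (x₀ - q)) = (1 - t) * dist p q := by
    intro p q
    rw [dist_eq_norm, dist_eq_norm, show p + t • (x₀ - p) - (q + t • (x₀ - q)) =
      (1 - t) • (p - q) by module, norm_smul, Real.norm_eq_abs, abs_of_nonneg (by linarith)]
  have key2 : ∀ p ∈ C, dist p (p + t • (x₀ - p)) ≤ ε := by
    intro p hp
    rw [dist_self_add_right, norm_smul, Real.norm_eq_abs, abs_of_pos ht0, ← dist_eq_norm]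
    exact (mul_le_mul_of_nonneg_left (hD _ hx₀ _ hp) ht0.le).trans htD
  refine ⟨1 - t, by linarith, by linarith, fun x => (fun p => p + t • (x₀ - p)) '' F x, ?_, ?_⟩
  · intro x hx
    obtain ⟨h1, h2, h3, h4⟩ := hF x hx
    refine ⟨h1.image (by fun_prop), h2.image _, ?_, ?_⟩
    · rintro _ ⟨p, hp, rfl⟩
      exact hC.add_smul_sub_mem (h3 hp) hx₀ ⟨ht0.le, ht1⟩
    · rintro y hy _ ⟨p, hp, rfl⟩
      obtain ⟨q, hq, hpq⟩ := h4 y hy p hp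
      refine ⟨_, ⟨q, hq, rfl⟩, ?_⟩
      rw [key]
      exact mul_le_mul_of_nonneg_left (by linarith) (by linarith)
  · intro x hx
    obtain ⟨h1, h2, h3, h4⟩ := hF x hx
    refine ⟨fun p hp => ⟨_, ⟨p, hp, rfl⟩, key2 p (h3 hp)⟩, ?_⟩
    rintro _ ⟨p, hp, rfl⟩
    exact ⟨p, hp, key2 p (h3 hp)⟩

lemma branch_good {C : Set X} (hC : Convex ℝ C) {F : X → Set X} {L L' σ R : ℝ}
    (hF : Good C L F) (hL0 : 0 ≤ L) (hLL : L ≤ L') (hσ : 0 ≤ σ) (hR : 0 ≤ R)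
    {Q : Finset X} (hQ : ∀ q ∈ Q, q ∈ C) {q : X} (hq : q ∈ Q) {a p₀ : X} (ha : a ∈ C)
    (hp₀ : p₀ ∈ F a) (e : X → X) (heC : ∀ x ∈ C, dist x a ≤ R → e x ∈ C)
    (heL : ∀ x ∈ C, ∀ y ∈ C, dist x a ≤ R → dist y a ≤ R → dist (e x) (e y) ≤ L' * dist x y)
    (heq : ∀ x ∈ C, dist x a ≤ R → dist (e x) q ≤ L' * (R - dist x a))
    (hqp : dist q p₀ ≤ σ - L * R) (hL1 : L' ≤ 1) :
    Good C L' (fun x => (⋃ z ∈ Q, pt 1 σ z '' F x) ∪ {w | dist x a ≤ R ∧ w = e x}) ∧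
    Near C (σ + R) F (fun x => (⋃ z ∈ Q, pt 1 σ z '' F x) ∪ {w | dist x a ≤ R ∧ w = e x}) := by
  have hmv : ∀ z p : X, dist (pt 1 σ z p) p ≤ σ := by
    intro z p
    rw [pt_move, prof]
    rcases le_total (dist p z) σ with h | h
    · have := le_max_left 0 (min (dist p z) (1 * (dist p z - σ)))
      linarith
    · have : min (dist p z) (1 * (dist p z - σ)) = dist p z - σ := by
        rw [one_mul]; apply min_eq_right; linarith
      have := le_max_right 0 (min (dist p z) (1 * (dist p z - σ)))
      linarith
  constructor
  · intro x hx
    obtain ⟨h1, h2, h3, h4⟩ := hF x hx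
    refine ⟨?_, ?_, ?_, ?_⟩
    · apply IsCompact.union
      · exact Q.isCompact_biUnion fun z _ => h1.image (pt_continuous le_rfl hσ z)
      · apply Set.Finite.isCompact
        apply (Set.finite_singleton (e x)).subset
        rintro w ⟨_, rfl⟩; rfl
    · obtain ⟨p, hp⟩ := h2
      exact ⟨pt 1 σ q p, Or.inl (mem_biUnion hq ⟨p, hp, rfl⟩)⟩
    · rintro w (hw | ⟨hw, rfl⟩)
      · simp only [mem_iUnion] at hw
        obtain ⟨z, hz, p, hp, rfl⟩ := hw
        exact pt_mem hC _ _ (hQ z hz) (h3 hp)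
      · exact heC x hx hw
    · rintro y hy w (hw | ⟨hw, rfl⟩)
      · simp only [mem_iUnion] at hw
        obtain ⟨z, hz, p, hp, rfl⟩ := hw
        obtain ⟨p', hp', hd⟩ := h4 y hy p hp
        refine ⟨pt 1 σ z p', Or.inl (mem_biUnion hz ⟨p', hp', rfl⟩), ?_⟩
        have := pt_lip le_rfl hσ z p p'
        have := mul_le_mul_of_nonneg_right hLL (dist_nonneg (x := x) (y := y))
        linarith
      · by_cases hyR : dist y a ≤ R
        · exact ⟨e y, Or.inr ⟨hyR, rfl⟩, heL x hx y hy hw hyR⟩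
        · push Not at hyR
          obtain ⟨p', hp', hd⟩ := (hF a ha).2.2.2 y hy p₀ hp₀
          refine ⟨pt 1 σ q p', Or.inl (mem_biUnion hq ⟨p', hp', rfl⟩), ?_⟩
          have hc := pt_dist_center 1 σ q p'
          have h5 : dist p' q ≤ σ + L * (dist y a - R) := by
            have := dist_triangle p' p₀ q
            rw [dist_comm p' p₀, dist_comm p₀ q] at this
            rw [dist_comm a y] at hd
            nlinarith
          have h6 : prof 1 σ (dist p' q) ≤ L * (dist y a - R) := by
            apply max_le (mul_nonneg hL0 (by linarith))
            exact (min_le_right _ _).trans (by linarith)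
          have h7 := heq x hx hw
          have h8 := dist_triangle (e x) q (pt 1 σ q p')
          rw [dist_comm q] at h8
          have h9 : dist y a - dist x a ≤ dist x y := by
            have := dist_triangle y x a
            rw [dist_comm y x] at this; linarith
          have h10 := mul_le_mul_of_nonneg_right hLL (sub_nonneg.2 hyR.le)
          have h11 := mul_le_mul_of_nonneg_left h9 (hL0.trans hLL)
          linarith
  · intro x hx
    obtain ⟨h1, h2, h3, h4⟩ := hF x hx
    constructor
    · intro p hp
      refine ⟨pt 1 σ q p, Or.inl (mem_biUnion hq ⟨p, hp, rfl⟩), ?_⟩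
      rw [dist_comm]; linarith [hmv q p]
    · rintro w (hw | ⟨hw, rfl⟩)
      · simp only [mem_iUnion] at hw
        obtain ⟨z, hz, p, hp, rfl⟩ := hw
        refine ⟨p, hp, ?_⟩
        rw [dist_comm]; linarith [hmv z p]
      · obtain ⟨p', hp', hd⟩ := (hF a ha).2.2.2 x hx p₀ hp₀
        refine ⟨p', hp', ?_⟩
        have h5 := heq x hx hw
        have h6 := dist_triangle4 (e x) q p₀ p'
        rw [dist_comm p' (e x)]
        rw [dist_comm a x] at hd
        have := mul_le_mul_of_nonneg_left hw hL0
        have := dist_nonneg (x := x) (y := a)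
        have : L' * (R - dist x a) ≤ 1 * (R - dist x a) :=
          mul_le_mul_of_nonneg_right hL1 (by linarith)
        linarith

end helpers

section helpers
variable {X : Type*} [NormedAddCommGroup X] [NormedSpace ℝ X]

lemma chain_exists {C : Set X} (hC : Convex ℝ C) {F : X → Set X} {L σ η : ℝ}
    (hF : Good C L F) (hL0 : 0 ≤ L) (hL1 : L < 1) (hσ : 0 < σ) (hη : 0 < η) {x₀ : X}
    (hx₀ : x₀ ∈ C) :
    ∃ (y P : ℕ → X) (J : ℕ), y 0 = x₀ ∧ (∀ k, y k ∈ C ∧ P k ∈ F (y k) ∧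
      ∀ p ∈ F (y k), dist (y k) (P k) ≤ dist (y k) p) ∧
      (∀ k < J, σ + η < dist (y k) (P k) ∧ dist (y k) (y (k+1)) = dist (y k) (P k) - σ ∧
        dist (P k) (y (k+1)) = σ ∧ dist (y (k+1)) (P (k+1)) < dist (y k) (P k)) ∧
      dist (y J) (P J) ≤ σ + η := by
  have hP : ∀ x : X, ∃ p, x ∈ C → p ∈ F x ∧ ∀ q ∈ F x, dist x p ≤ dist x q := by
    intro x
    by_cases hx : x ∈ C
    · obtain ⟨p, hp, h⟩ := (hF x hx).1.exists_isMinOn (hF x hx).2.1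
        (f := fun q => dist x q) (by fun_prop)
      exact ⟨p, fun _ => ⟨hp, fun q hq => h hq⟩⟩
    · exact ⟨x, fun h => absurd h hx⟩
  choose P hP using hP
  have hT : ∀ x : X, ∃ z, x ∈ C → z ∈ C ∧ (σ + η < dist x (P x) →
      dist x z = dist x (P x) - σ ∧ dist (P x) z = σ) := by
    intro x
    by_cases hx : x ∈ C
    · by_cases hd : σ + η < dist x (P x)
      · have hd0 : 0 < dist x (P x) := by linarith
        refine ⟨x + ((dist x (P x) - σ) / dist x (P x)) • (P x - x), fun _ => ⟨?_, fun _ => ⟨?_, ?_⟩⟩⟩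
        · apply hC.add_smul_sub_mem hx ((hF x hx).2.2.1 (hP x hx).1)
          exact ⟨div_nonneg (by linarith) hd0.le, div_le_one_of_le₀ (by linarith) hd0.le⟩
        · rw [dist_self_add_right, norm_smul, Real.norm_eq_abs,
            abs_of_nonneg (div_nonneg (by linarith) hd0.le), ← dist_eq_norm, dist_comm (P x) x]
          field_simp
        · have : P x - (x + ((dist x (P x) - σ) / dist x (P x)) • (P x - x)) =
              (σ / dist x (P x)) • (P x - x) := by
            have h2 : (dist x (P x) - σ) / dist x (P x) = 1 - σ / dist x (P x) := by
              field_simp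
            rw [h2]; module
          rw [dist_eq_norm, this, norm_smul, Real.norm_eq_abs,
            abs_of_nonneg (div_nonneg hσ.le hd0.le), ← dist_eq_norm, dist_comm (P x) x]
          field_simp
      · exact ⟨x, fun _ => ⟨hx, fun h => absurd h hd⟩⟩
    · exact ⟨x, fun h => absurd h hx⟩
  choose T hT using hT
  set y : ℕ → X := fun k => T^[k] x₀ with hy
  have hys : ∀ k, y (k+1) = T (y k) := fun k => Function.iterate_succ_apply' T k x₀
  have hyC : ∀ k, y k ∈ C := by
    intro k
    induction k with
    | zero => exact hx₀
    | succ k ih => rw [hys]; exact (hT _ ih).1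
  have hdec : ∀ k, σ + η < dist (y k) (P (y k)) →
      dist (y (k+1)) (P (y (k+1))) - σ ≤ L * (dist (y k) (P (y k)) - σ) := by
    intro k hk
    obtain ⟨h1, h2⟩ := (hT _ (hyC k)).2 hk
    rw [← hys] at h1 h2
    obtain ⟨q, hq, hqd⟩ := (hF _ (hyC k)).2.2.2 _ (hyC (k+1)) _ (hP _ (hyC k)).1
    have h3 := (hP _ (hyC (k+1))).2 q hq
    have h4 := dist_triangle (y (k+1)) (P (y k)) q
    rw [dist_comm (y (k+1)) (P (y k)), h2] at h4
    rw [h1] at hqd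
    linarith
  have hex : ∃ k, dist (y k) (P (y k)) ≤ σ + η := by
    by_contra h
    push Not at h
    have hg : ∀ k, dist (y k) (P (y k)) - σ ≤ L ^ k * (dist (y 0) (P (y 0)) - σ) := by
      intro k
      induction k with
      | zero => simp
      | succ k ih =>
        calc _ ≤ _ := hdec k (h k)
          _ ≤ L * (L ^ k * (dist (y 0) (P (y 0)) - σ)) := mul_le_mul_of_nonneg_left ih hL0
          _ = _ := by ring
    have ht : Tendsto (fun k => L ^ k * (dist (y 0) (P (y 0)) - σ)) atTop (nhds 0) := by
      simpa using (tendsto_pow_atTop_nhds_zero_of_lt_one hL0 hL1).mul_const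
        (dist (y 0) (P (y 0)) - σ)
    obtain ⟨k, hk⟩ := (ht.eventually (gt_mem_nhds hη)).exists
    linarith [h k, hg k]
  classical
  refine ⟨y, fun k => P (y k), Nat.find hex, rfl, fun k => ⟨hyC k, (hP _ (hyC k)).1, (hP _ (hyC k)).2⟩,
    fun k hk => ?_, Nat.find_spec hex⟩
  have h := Nat.find_min hex hk
  push Not at h
  have h1 := (hT _ (hyC k)).2 h
  rw [← hys] at h1
  refine ⟨h, h1.1, h1.2, ?_⟩
  have := hdec k h
  simp only
  nlinarith
end helpers

section helpers
variable {X : Type*} [NormedAddCommGroup X] [NormedSpace ℝ X]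

lemma exists_pos_lb (A : ℕ → Prop) (f : ℕ → ℝ) (i : ℕ) (h : ∀ l < i, A l → 0 < f l) :
    ∃ μ > 0, ∀ l < i, A l → μ ≤ f l := by
  induction i with
  | zero => exact ⟨1, one_pos, by simp⟩
  | succ i ih =>
    obtain ⟨μ, h0, hμ⟩ := ih fun l hl => h l (by omega)
    by_cases hA : A i
    · refine ⟨min μ (f i), lt_min h0 (h i (by omega) hA), fun l hl hAl => ?_⟩
      rcases Nat.lt_succ_iff_lt_or_eq.1 hl with h1 | rfl
      · exact (min_le_left _ _).trans (hμ l h1 hAl)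
      · exact min_le_right _ _
    · refine ⟨μ, h0, fun l hl hAl => ?_⟩
      rcases Nat.lt_succ_iff_lt_or_eq.1 hl with h1 | rfl
      · exact hμ l h1 hAl
      · exact absurd hAl hA

lemma pt_one_move {σ : ℝ} (z p : X) (hσ : 0 ≤ σ) : dist (pt 1 σ z p) p ≤ σ := by
  rw [pt_move, prof]
  rcases le_total (dist p z) σ with h | h
  · have := le_max_left 0 (min (dist p z) (1 * (dist p z - σ)))
    linarith
  · have : min (dist p z) (1 * (dist p z - σ)) = dist p z - σ := by
      rw [one_mul]; apply min_eq_right; linarith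
    have := le_max_right 0 (min (dist p z) (1 * (dist p z - σ)))
    linarith

lemma fatten {C : Set X} (hC : Convex ℝ C) {F : X → Set X} {L σ : ℝ}
    (hF : Good C L F) (hL0 : 0 ≤ L) (hL1 : L < 1) (hσ : 0 < σ) {x₀ : X} (hx₀ : x₀ ∈ C) :
    ∃ (S : Finset X) (n : X → X) (N : ℕ) (L' : ℝ), x₀ ∈ S ∧ (∀ s ∈ S, s ∈ C) ∧
      (∀ s ∈ S, n s ∈ S) ∧ (∀ k ≥ N, n^[k] x₀ = n^[N] x₀) ∧ 0 ≤ L' ∧ L' < 1 ∧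
      ∀ δ₀ > 0, ∃ δ, 0 < δ ∧ δ ≤ δ₀ ∧ ∃ G, Good C L' G ∧ Near C (3 * σ) F G ∧
        ∀ s ∈ S, (∃ p ∈ G s, dist p (n s) ≤ δ) ∧
          (∀ p ∈ G s, δ ≤ dist p (n s) → dist s (n s) + δ ≤ dist s p) := by
  classical
  set η := (1 - L) * σ / 8 with hη
  have hη0 : 0 < η := by have : 0 < 1 - L := by linarith
                         positivity
  have hησ : η ≤ σ / 8 := by rw [hη]; nlinarith
  set R := σ / 4 with hR
  have hR0 : 0 < R := by positivity
  have hRη : (1 - L) * R = 2 * η := by rw [hR, hη]; ring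
  obtain ⟨y, P, J, hy0, hyP, hJ, hJe⟩ := chain_exists hC hF hL0 hL1 hσ hη0 hx₀
  set a := y J with ha
  have haC : a ∈ C := (hyP J).1
  have hpC : P J ∈ C := (hF a haC).2.2.1 (hyP J).2.1
  -- direction
  obtain ⟨u, hu1, huC, huP⟩ : ∃ u : X, (‖u‖ = 1 ∨ u = 0) ∧
      (∀ ν, 0 ≤ ν → ν ≤ R → a + ν • u ∈ C) ∧
      (∀ ν, 0 ≤ ν → ν ≤ R → dist (a + ν • u) (P J) ≤ max R (σ + η - ν)) := by
    by_cases hd : R ≤ dist a (P J)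
    · have hd0 : 0 < dist a (P J) := by linarith
      have hn : ‖P J - a‖ = dist a (P J) := by rw [dist_comm, dist_eq_norm]
      refine ⟨(dist a (P J))⁻¹ • (P J - a), Or.inl ?_, ?_, ?_⟩
      · rw [norm_smul, hn, Real.norm_eq_abs, abs_of_pos (by positivity)]
        field_simp
      · intro ν h0 h1
        rw [smul_smul]
        apply hC.add_smul_sub_mem haC hpC
        refine ⟨by positivity, ?_⟩
        rw [← div_eq_mul_inv, div_le_one hd0]; linarith
      · intro ν h0 h1
        apply le_max_of_le_right
        have : a + ν • (dist a (P J))⁻¹ • (P J - a) - P J =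
            -((1 - ν / dist a (P J)) • (P J - a)) := by
          rw [div_eq_mul_inv]; module
        rw [dist_eq_norm, this, norm_neg, norm_smul, hn, Real.norm_eq_abs, abs_of_nonneg]
        · have : (1 - ν / dist a (P J)) * dist a (P J) = dist a (P J) - ν := by field_simp
          linarith
        · rw [sub_nonneg, div_le_one hd0]; linarith
    · refine ⟨0, Or.inr rfl, ?_, ?_⟩
      · intro ν _ _; simpa using haC
      · intro ν _ _; apply le_max_of_le_left
        push Not at hd
        simpa using hd.le
  have hu : ‖u‖ ≤ 1 := by rcases hu1 with h | h <;> simp [h]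
  have hdu : ∀ s t : ℝ, dist (a + s • u) (a + t • u) ≤ |s - t| := by
    intro s t
    rw [dist_add_left, dist_eq_norm, ← sub_smul, norm_smul, Real.norm_eq_abs]
    exact mul_le_of_le_one_right (abs_nonneg _) hu
  set e : X → X := fun x => a + dist x a • u with he
  have hiex : ∃ l, l ≤ J ∧ (l = J ∨ (dist (y l) a ≤ R ∧
      dist (e (y l)) (y l) ≤ dist (y l) (P l) - σ)) := ⟨J, le_rfl, Or.inl rfl⟩
  obtain ⟨i, ⟨hiJ, hi⟩, himin⟩ : ∃ i, (i ≤ J ∧ (i = J ∨ (dist (y i) a ≤ R ∧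
      dist (e (y i)) (y i) ≤ dist (y i) (P i) - σ))) ∧ ∀ l < i, dist (y l) a ≤ R →
      dist (y l) (P l) - σ < dist (e (y l)) (y l) := by
    refine ⟨Nat.find hiex, Nat.find_spec hiex, fun l hl h => ?_⟩
    have h1 := Nat.find_min hiex hl
    have h2 := (Nat.find_spec hiex).1
    by_contra h3
    push Not at h3
    exact h1 ⟨by omega, Or.inr ⟨h, h3⟩⟩
  set τ := dist (y i) a with hτ
  have hτ0 : 0 ≤ τ := dist_nonneg
  have hτR : τ ≤ R := by
    rcases hi with h | h
    · rw [hτ, h, ha, dist_self]; exact hR0.le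
    · exact h.1
  set w := a + τ • u with hw
  have hwC : w ∈ C := huC τ hτ0 hτR
  have hwa : dist w a = τ * ‖u‖ := by
    rw [hw, dist_self_add_left, norm_smul, Real.norm_eq_abs, abs_of_nonneg hτ0]
  have hwa' : dist w a ≤ R := by
    rw [hwa]; exact (mul_le_of_le_one_right hτ0 hu).trans hτR
  have hew : e w = w := by
    simp only [he, hwa]
    rcases hu1 with h | h
    · rw [h, mul_one]
    · rw [hw, h]; simp
  obtain ⟨μ, hμ0, hμ⟩ := exists_pos_lb (fun l => dist (y l) a ≤ R)
    (fun l => dist (e (y l)) (y l) - (dist (y l) (P l) - σ)) i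
    (fun l hl h => by have := himin l hl h; linarith)
  obtain ⟨t, ht0, ht1, htη, htμ⟩ : ∃ t : ℝ, 0 < t ∧ t ≤ 1 ∧ t * R ≤ η / 2 ∧ t * R ≤ μ / 2 := by
    refine ⟨min 1 (min (η / 2 / R) (μ / 2 / R)), ?_, min_le_left _ _, ?_, ?_⟩
    · exact lt_min one_pos (lt_min (by positivity) (by positivity))
    · rw [← le_div_iff₀ hR0]; exact (min_le_right _ _).trans (min_le_left _ _)
    · rw [← le_div_iff₀ hR0]; exact (min_le_right _ _).trans (min_le_right _ _)
  -- coefficient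
  set ν : ℝ → ℝ := fun s => τ + (1 - t) * (s - τ) with hν
  have hνd : ∀ s s', ν s - ν s' = (1 - t) * (s - s') := by intro s s'; simp only [hν]; ring
  have hν0 : ∀ s, 0 ≤ s → 0 ≤ ν s := by
    intro s hs
    have : ν s = t * τ + (1 - t) * s := by simp only [hν]; ring
    rw [this]
    have := mul_nonneg ht0.le hτ0
    have := mul_nonneg (sub_nonneg.2 ht1) hs
    linarith
  have hνR : ∀ s, s ≤ R → ν s ≤ R := by
    intro s hs
    have h1 := hνd s R
    have h2 : ν R = R - t * (R - τ) := by simp only [hν]; ring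
    have := mul_nonneg ht0.le (sub_nonneg.2 hτR)
    have := mul_nonneg (sub_nonneg.2 ht1) (sub_nonneg.2 hs)
    linarith
  set e' : X → X := fun x => a + ν (dist x a) • u with he'
  have hee : ∀ x, dist x a ≤ R → dist (e' x) (e x) ≤ t * R := by
    intro x hx
    refine (hdu _ _).trans ?_
    have : ν (dist x a) - dist x a = t * (τ - dist x a) := by simp only [hν]; ring
    rw [this, abs_mul, abs_of_pos ht0]
    apply mul_le_mul_of_nonneg_left _ ht0.le
    rw [abs_le]; constructor <;> linarith [dist_nonneg (x := x) (y := a)]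
  have hνm : ν τ = τ := by simp [hν]
  have he'i : e' (y i) = w := by simp only [he', ← hτ, hνm, hw]
  have he'w : e' w = w := by
    rcases hu1 with h | h
    · change a + ν (dist w a) • u = w
      rw [hwa, h, mul_one, hνm]
    · simp [he', hw, h]
  have hyw : ∀ l < i, y l ≠ w := by
    intro l hl h
    have h1 := himin l hl (by rw [h]; exact hwa')
    rw [h, hew, dist_self, ← h] at h1
    have := (hJ l (by omega)).1
    linarith
  have hmono : ∀ m l, l < m → m ≤ J → dist (y m) (P m) < dist (y l) (P l) := by
    intro m
    induction m with
    | zero => intro l hl; omega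
    | succ m ih =>
      intro l hl hm
      have h1 := (hJ m (by omega)).2.2.2
      rcases Nat.lt_succ_iff_lt_or_eq.1 hl with h | rfl
      · exact h1.trans (ih l h (by omega))
      · exact h1
  have hyi : ∀ l < i, y l ≠ y i := by
    intro l hl h
    have h1 := hmono i l hl hiJ
    have h2 := (hyP l).2.2 (P i) (by rw [h]; exact (hyP i).2.1)
    rw [h] at h1 h2
    linarith
  set n : X → X := fun s => if s = w ∨ s = y i then w else
    if h : ∃ l, l < i ∧ s = y l then y (Nat.find h + 1) else w with hn
  have hyinj : ∀ l < i, ∀ m < i, y l = y m → l = m := by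
    intro l hl m hm h
    by_contra hne
    have key : ∀ l m, l < m → m < i → y l = y m → False := by
      intro l m hlm hm h
      have h1 := hmono m l hlm (by omega)
      have h2 := (hyP l).2.2 (P m) (by rw [h]; exact (hyP m).2.1)
      rw [h] at h1 h2
      linarith
    rcases lt_or_gt_of_ne hne with h1 | h1
    · exact key l m h1 hm h
    · exact key m l h1 hl h.symm
  have hnl : ∀ l < i, n (y l) = y (l+1) := by
    intro l hl
    have hex : ∃ m, m < i ∧ y l = y m := ⟨l, hl, rfl⟩
    have h1 : Nat.find hex = l := (hyinj l hl _ (Nat.find_spec hex).1 (Nat.find_spec hex).2).symm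
    simp only [hn]
    rw [if_neg (by rintro (h | h); exacts [hyw l hl h, hyi l hl h]), dif_pos hex, h1]
  have hni : n (y i) = w := by simp [hn]
  have hnw : n w = w := by simp [hn]
  have hit : ∀ k ≤ i, n^[k] x₀ = y k := by
    intro k
    induction k with
    | zero => intro _; exact hy0.symm
    | succ k ih => intro hk; rw [Function.iterate_succ_apply', ih (by omega), hnl k (by omega)]
  have hit2 : ∀ k, n^[i + 1 + k] x₀ = w := by
    intro k
    induction k with
    | zero => rw [add_zero, Function.iterate_succ_apply', hit i le_rfl, hni]
    | succ k ih => rw [← add_assoc, Function.iterate_succ_apply', ih, hnw]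
  set S : Finset X := insert w ((Finset.range (i+1)).image y) with hS
  have hSc : ∀ s ∈ S, s = w ∨ s = y i ∨ ∃ l < i, s = y l := by
    intro s hs
    rw [hS, Finset.mem_insert, Finset.mem_image] at hs
    rcases hs with h | ⟨l, hl, rfl⟩
    · exact Or.inl h
    · rw [Finset.mem_range, Nat.lt_succ_iff_lt_or_eq] at hl
      rcases hl with h | rfl
      · exact Or.inr (Or.inr ⟨l, h, rfl⟩)
      · exact Or.inr (Or.inl rfl)
  have hyS : ∀ l ≤ i, y l ∈ S := fun l hl =>
    Finset.mem_insert_of_mem (Finset.mem_image_of_mem y (Finset.mem_range.2 (by omega)))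
  have hwS : w ∈ S := Finset.mem_insert_self _ _
  have hSC : ∀ s ∈ S, s ∈ C := by
    intro s hs
    rcases hSc s hs with rfl | rfl | ⟨l, -, rfl⟩
    exacts [hwC, (hyP _).1, (hyP _).1]
  refine ⟨S, n, i+1, max L (1 - t), ?_, hSC, ?_, ?_, le_max_of_le_left hL0,
    max_lt hL1 (by linarith), ?_⟩
  · rw [← hy0]; exact hyS 0 (by omega)
  · intro s hs
    rcases hSc s hs with rfl | rfl | ⟨l, hl, rfl⟩
    · rw [hnw]; exact hwS
    · rw [hni]; exact hwS
    · rw [hnl l hl]; exact hyS _ (by omega)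
  · intro k hk
    obtain ⟨m, rfl⟩ := Nat.exists_eq_add_of_le hk
    rw [hit2, ← add_zero (i+1), hit2]
  intro δ₀ hδ₀
  obtain ⟨δ, hδ0, hδ1, hδμ, hδη⟩ : ∃ δ : ℝ, 0 < δ ∧ δ ≤ δ₀ ∧ δ ≤ μ / 2 ∧ δ ≤ η / 2 :=
    ⟨min δ₀ (min (μ / 2) (η / 2)), lt_min hδ₀ (lt_min (by positivity) (by positivity)),
      min_le_left _ _, (min_le_right _ _).trans (min_le_left _ _),
      (min_le_right _ _).trans (min_le_right _ _)⟩
  set q := a + ν R • u with hq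
  have hqC : q ∈ C := huC _ (hν0 _ hR0.le) (hνR _ le_rfl)
  have hσ' : 0 ≤ σ - δ := by linarith
  have hLR : L * R = R - 2 * η := by linarith
  have htt : 1 - t ≤ max L (1 - t) := le_max_right _ _
  obtain ⟨hG, hNear⟩ := branch_good (Q := insert q S) (q := q) (R := R) (a := a) (p₀ := P J) hC hF hL0
    (le_max_left L (1 - t)) hσ' hR0.le
    (by intro z hz
        rcases Finset.mem_insert.1 hz with rfl | h
        exacts [hqC, hSC _ h]) (Finset.mem_insert_self _ _) haC (hyP J).2.1 e'
    (fun x _ hx => huC _ (hν0 _ dist_nonneg) (hνR _ hx))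
    (by intro x _ y _ hx hy
        refine (hdu _ _).trans ?_
        rw [hνd, abs_mul, abs_of_nonneg (sub_nonneg.2 ht1)]
        have : |dist x a - dist y a| ≤ dist x y := abs_dist_sub_le x y a
        exact mul_le_mul htt this (abs_nonneg _) (by linarith))
    (by intro x _ hx
        refine (hdu _ _).trans ?_
        rw [hνd, abs_mul, abs_of_nonneg (sub_nonneg.2 ht1), abs_sub_comm,
          abs_of_nonneg (sub_nonneg.2 hx)]
        exact mul_le_mul_of_nonneg_right htt (sub_nonneg.2 hx))
    (by refine (huP _ (hν0 _ hR0.le) (hνR _ le_rfl)).trans (max_le ?_ ?_)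
        · linarith
        · have : ν R = R - t * R + t * τ := by simp only [hν]; ring
          have := mul_nonneg ht0.le hτ0
          linarith) (max_le hL1.le (by linarith))
  refine ⟨δ, hδ0, hδ1, _, hG, hNear.mono (by linarith), ?_⟩
  have hfar : ∀ l, ∀ z p : X, p ∈ F (y l) →
      dist (y l) (P l) - σ + δ ≤ dist (y l) (pt 1 (σ - δ) z p) := by
    intro l z p hp
    have h1 := (hyP l).2.2 p hp
    have h2 := pt_one_move z p hσ'
    have h3 := dist_triangle (y l) (pt 1 (σ - δ) z p) p
    linarith
  intro s hs
  rcases hSc s hs with rfl | rfl | ⟨l, hl, rfl⟩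
  · refine ⟨⟨w, Or.inr ⟨hwa', he'w.symm⟩, ?_⟩, ?_⟩
    · rw [hnw, dist_self]; exact hδ0.le
    · intro p _ h
      rw [hnw] at h ⊢
      rw [dist_self, zero_add, dist_comm]; exact h
  · refine ⟨⟨w, Or.inr ⟨hτR, he'i.symm⟩, ?_⟩, ?_⟩
    · rw [hni, dist_self]; exact hδ0.le
    · intro p hp h
      rw [hni] at h ⊢
      rcases hp with hp | ⟨_, hp⟩
      · rcases hi with hi | hi
        · have : w = y i := by
            have : τ = 0 := by rw [hτ, hi, ha, dist_self]
            rw [hw, this, zero_smul, add_zero, hi]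
          rw [this] at h ⊢
          rw [dist_self, zero_add, dist_comm]; exact h
        · simp only [mem_iUnion] at hp
          obtain ⟨z, hz, p, hp, rfl⟩ := hp
          have h1 := hfar i z p hp
          have h2 : e (y i) = w := rfl
          have h3 := hi.2
          rw [h2, dist_comm] at h3
          linarith
      · rw [hp, he'i, dist_self] at h
        linarith
  · rw [hnl l hl]
    obtain ⟨h1, h2, h3, -⟩ := hJ l (by omega)
    refine ⟨⟨pt 1 (σ - δ) (y (l+1)) (P l), Or.inl (mem_biUnion (Finset.mem_insert_of_mem (hyS (l+1) (by omega))) ⟨P l, (hyP l).2.1, rfl⟩), ?_⟩, ?_⟩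
    · rw [pt_dist_center, h3]
      refine (prof_le_mul (by norm_num) (by linarith)).trans (by linarith)
    · intro p hp _
      rw [h2]
      rcases hp with hp | ⟨hpR, hp⟩
      · simp only [mem_iUnion] at hp
        obtain ⟨z, hz, p, hp, rfl⟩ := hp
        exact hfar l z p hp
      · have h4 := hμ l hl hpR
        have h5 := hee (y l) hpR
        have h6 := dist_triangle (y l) (e' (y l)) (e (y l))
        rw [hp]
        rw [dist_comm (y l) (e (y l))] at h6
        linarith
end helpers

section helpers
variable {X : Type*} [NormedAddCommGroup X] [NormedSpace ℝ X]

lemma local_mod {C : Set X} (hC : Convex ℝ C) {F : X → Set X} {L κ r δ : ℝ}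
    (hF : Good C L F) (hL0 : 0 ≤ L) (hκ : 0 < κ) (hL1 : L + κ ≤ 1) (hr : 0 < r) (hδ : 0 < δ)
    (hδr : δ ≤ κ * r) {a b c : X} (ha : a ∈ C) (hc : c ∈ C) (hb : b ∈ F a) (hbc : dist b c ≤ δ) :
    ∃ F' : X → Set X, Good C (L + κ) F' ∧ Near C (2 * ((1 + κ) * r / κ)) F F' ∧
      (∀ x, (1 + κ) * r / κ ≤ dist x a → F' x = F x) ∧ c ∈ F' a ∧
      ∀ p ∈ F' a, p = c ∨ (p ∈ F a ∧ δ ≤ dist p c) := by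
  classical
  set R := (1 + κ) * r / κ with hR
  have hRκ : R * κ = (1 + κ) * r := by rw [hR]; field_simp
  have hR0 : 0 < R := by positivity
  have hrR : (1 + κ) * r ≤ R := by rw [← hRκ]; nlinarith
  have hK : 1 ≤ 1 + κ := by linarith
  set ψ : X → X := pt (1 + κ) r a with hψ
  have hψC : ∀ x ∈ C, ψ x ∈ C := fun x hx => pt_mem hC _ _ ha hx
  have hψl : ∀ x y, dist (ψ x) (ψ y) ≤ (1 + κ) * dist x y := fun x y => pt_lip hK hr.le a x y
  have hψa : ∀ x, r ≤ dist x a → dist (ψ x) a ≤ (1 + κ) * (dist x a - r) := by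
    intro x hx
    rw [hψ, pt_dist_center]; exact prof_le_mul (by linarith) hx
  have hψR : ∀ x, R ≤ dist x a → ψ x = x := by
    intro x hx
    rw [← dist_eq_zero, hψ, pt_move, prof]
    have : min (dist x a) ((1 + κ) * (dist x a - r)) = dist x a := by
      apply min_eq_left
      nlinarith
    rw [this, max_eq_right dist_nonneg, sub_self]
  have hψd : ∀ x, dist (ψ x) x ≤ R := by
    intro x
    rcases le_total R (dist x a) with h | h
    · rw [hψR x h, dist_self]; exact hR0.le
    · rw [hψ, pt_move]
      linarith [prof_nonneg (1 + κ) r (dist x a)]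
  set E : X → Set X := fun x => (fun p => c + (dist x a / r) • (p - c)) '' (F a ∩ closedBall c δ) ∪
    (F a ∩ {p | δ ≤ dist p c}) with hE
  set F' : X → Set X := fun x => if r ≤ dist x a then F (ψ x) else E x with hF'
  have hLK : L * (1 + κ) ≤ L + κ := by nlinarith
  have hmv : ∀ x, dist x a < r → ∀ p, dist p c ≤ δ →
      dist p (c + (dist x a / r) • (p - c)) ≤ κ * (r - dist x a) := by
    intro x hx p hp
    have : p - (c + (dist x a / r) • (p - c)) = (1 - dist x a / r) • (p - c) := by module
    have h1 : 0 ≤ 1 - dist x a / r := by rw [sub_nonneg, div_le_one hr]; exact hx.le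
    rw [dist_eq_norm, this, norm_smul, Real.norm_eq_abs, abs_of_nonneg h1, ← dist_eq_norm]
    calc _ ≤ (1 - dist x a / r) * (κ * r) := mul_le_mul_of_nonneg_left (hp.trans hδr) h1
      _ = _ := by field_simp
  have hEa : ∀ x, dist x a < r → (∀ p ∈ F a, ∃ w ∈ E x, dist p w ≤ κ * (r - dist x a)) ∧
      (∀ w ∈ E x, ∃ p ∈ F a, dist p w ≤ κ * (r - dist x a)) := by
    intro x hx
    have h0 : 0 ≤ κ * (r - dist x a) := mul_nonneg hκ.le (by linarith)
    constructor
    · intro p hp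
      rcases le_total (dist p c) δ with h | h
      · exact ⟨_, Or.inl ⟨p, ⟨hp, h⟩, rfl⟩, hmv x hx p h⟩
      · exact ⟨p, Or.inr ⟨hp, h⟩, by rw [dist_self]; exact h0⟩
    · rintro w (⟨p, ⟨hp, h⟩, rfl⟩ | ⟨hp, h⟩)
      · exact ⟨p, hp, hmv x hx p h⟩
      · exact ⟨w, hp, by rw [dist_self]; exact h0⟩
  refine ⟨F', ?_, ?_, ?_, ?_, ?_⟩
  · intro x hx
    by_cases hxr : r ≤ dist x a
    · have e1 : F' x = F (ψ x) := if_pos hxr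
      rw [e1]
      obtain ⟨h1, h2, h3, h4⟩ := hF (ψ x) (hψC x hx)
      refine ⟨h1, h2, h3, fun y hy p hp => ?_⟩
      by_cases hyr : r ≤ dist y a
      · have e2 : F' y = F (ψ y) := if_pos hyr
        rw [e2]
        obtain ⟨q, hq, hd⟩ := h4 _ (hψC y hy) p hp
        refine ⟨q, hq, ?_⟩
        have := mul_le_mul_of_nonneg_left (hψl x y) hL0
        have := mul_le_mul_of_nonneg_right hLK (dist_nonneg (x := x) (y := y))
        linarith
      · have e2 : F' y = E y := if_neg hyr
        rw [e2]
        push Not at hyr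
        obtain ⟨q, hq, hd⟩ := h4 a ha p hp
        obtain ⟨w, hw, hwd⟩ := (hEa y hyr).1 q hq
        refine ⟨w, hw, (dist_triangle p q w).trans ?_⟩
        have i1 := mul_le_mul_of_nonneg_left (hψa x hxr) hL0
        have i2 := mul_le_mul_of_nonneg_right hLK (sub_nonneg.2 hxr)
        have i3 : dist x a - dist y a ≤ dist x y := by
          have := dist_triangle x y a; linarith
        have i4 := mul_le_mul_of_nonneg_left i3 (by linarith : 0 ≤ L + κ)
        have i5 := mul_nonneg hL0 (sub_nonneg.2 hyr.le)
        linarith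
    · have e1 : F' x = E x := if_neg hxr
      rw [e1]
      push Not at hxr
      obtain ⟨h1, h2, h3, h4⟩ := hF a ha
      have hm0 : 0 ≤ dist x a / r := div_nonneg dist_nonneg hr.le
      have hm1 : dist x a / r ≤ 1 := by rw [div_le_one hr]; exact hxr.le
      refine ⟨?_, ?_, ?_, fun y hy w hw => ?_⟩
      · apply IsCompact.union
        · exact (h1.inter_right isClosed_closedBall).image (by fun_prop)
        · exact h1.inter_right (isClosed_le continuous_const (by fun_prop))
      · exact ⟨_, Or.inl ⟨b, ⟨hb, hbc⟩, rfl⟩⟩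
      · rintro w (⟨p, ⟨hp, h⟩, rfl⟩ | ⟨hp, h⟩)
        · exact hC.add_smul_sub_mem hc (h3 hp) ⟨hm0, hm1⟩
        · exact h3 hp
      · by_cases hyr : r ≤ dist y a
        · have e2 : F' y = F (ψ y) := if_pos hyr
          rw [e2]
          obtain ⟨p, hp, hpd⟩ := (hEa x hxr).2 w hw
          obtain ⟨q, hq, hd⟩ := h4 _ (hψC y hy) p hp
          refine ⟨q, hq, (dist_triangle w p q).trans ?_⟩
          rw [dist_comm w p]
          rw [dist_comm a] at hd
          have i1 := mul_le_mul_of_nonneg_left (hψa y hyr) hL0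
          have i2 := mul_le_mul_of_nonneg_right hLK (sub_nonneg.2 hyr)
          have i3 : dist y a - dist x a ≤ dist x y := by
            have := dist_triangle y x a; rw [dist_comm y x] at this; linarith
          have i4 := mul_le_mul_of_nonneg_left i3 (by linarith : 0 ≤ L + κ)
          have i5 := mul_nonneg hL0 (sub_nonneg.2 hxr.le)
          linarith
        · have e2 : F' y = E y := if_neg hyr
          rw [e2]
          rcases hw with ⟨p, ⟨hp, h⟩, rfl⟩ | ⟨hp, h⟩
          · refine ⟨_, Or.inl ⟨p, ⟨hp, h⟩, rfl⟩, ?_⟩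
            simp only
            rw [dist_add_left, dist_eq_norm, ← sub_smul, norm_smul, Real.norm_eq_abs,
              ← dist_eq_norm, ← sub_div, abs_div, abs_of_pos hr]
            have i1 : |dist x a - dist y a| ≤ dist x y := abs_dist_sub_le x y a
            calc _ ≤ dist x y / r * (κ * r) :=
                  mul_le_mul (div_le_div_of_nonneg_right i1 hr.le) ((mem_closedBall.1 h).trans hδr)
                    dist_nonneg (by positivity)
              _ = κ * dist x y := by field_simp
              _ ≤ _ := mul_le_mul_of_nonneg_right (by linarith) dist_nonneg
          · exact ⟨w, Or.inr ⟨hp, h⟩, by rw [dist_self]; positivity⟩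
  · intro x hx
    by_cases hxr : r ≤ dist x a
    · have e1 : F' x = F (ψ x) := if_pos hxr
      rw [e1]
      have hb : L * dist (ψ x) x ≤ 2 * R := by
        have := mul_le_mul_of_nonneg_left (hψd x) hL0
        nlinarith
      constructor
      · intro p hp
        obtain ⟨q, hq, hd⟩ := (hF x hx).2.2.2 _ (hψC x hx) p hp
        rw [dist_comm x] at hd
        exact ⟨q, hq, hd.trans hb⟩
      · intro p hp
        obtain ⟨q, hq, hd⟩ := (hF _ (hψC x hx)).2.2.2 x hx p hp
        exact ⟨q, hq, by rw [dist_comm]; exact hd.trans hb⟩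
    · have e1 : F' x = E x := if_neg hxr
      rw [e1]
      push Not at hxr
      have hb : L * dist x a + κ * (r - dist x a) ≤ 2 * R := by
        have h1 : L * dist x a ≤ 1 * r := mul_le_mul (by linarith) hxr.le dist_nonneg (by norm_num)
        have h2 := mul_nonneg hκ.le (dist_nonneg (x := x) (y := a))
        linarith
      constructor
      · intro p hp
        obtain ⟨q, hq, hd⟩ := (hF x hx).2.2.2 a ha p hp
        obtain ⟨w, hw, hwd⟩ := (hEa x hxr).1 q hq
        exact ⟨w, hw, (dist_triangle p q w).trans (by linarith)⟩
      · intro w hw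
        obtain ⟨q, hq, hqd⟩ := (hEa x hxr).2 w hw
        obtain ⟨p, hp, hd⟩ := (hF a ha).2.2.2 x hx q hq
        rw [dist_comm a, dist_comm q p] at hd
        exact ⟨p, hp, (dist_triangle p q w).trans (by linarith)⟩
  · intro x hx
    have : r ≤ dist x a := by nlinarith
    have e1 : F' x = F (ψ x) := if_pos this
    rw [e1, hψR x hx]
  · have e1 : F' a = E a := if_neg (by rw [dist_self]; linarith)
    rw [e1]
    exact Or.inl ⟨b, ⟨hb, hbc⟩, by simp⟩
  · have e1 : F' a = E a := if_neg (by rw [dist_self]; linarith)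
    rw [e1]
    rintro w (⟨p, ⟨hp, h⟩, rfl⟩ | ⟨hp, h⟩)
    · left; simp
    · exact Or.inr ⟨hp, h⟩
end helpers

section helpers
variable {X : Type*} [NormedAddCommGroup X] [NormedSpace ℝ X]

lemma sharpen {C : Set X} (hC : Convex ℝ C) {G : X → Set X} {L κ r δ : ℝ}
    (hG : Good C L G) (hL0 : 0 ≤ L) (hκ : 0 < κ) (hr : 0 < r) (hδ : 0 < δ)
    (hδr : δ ≤ κ * r) (S : Finset X) (hSC : ∀ s ∈ S, s ∈ C) (n : X → X)
    (hn : ∀ s ∈ S, n s ∈ S) (hsep : ∀ s ∈ S, ∀ t ∈ S, s ≠ t → (1 + κ) * r / κ ≤ dist s t)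
    (hL1 : L + S.card * κ ≤ 1) (hnear : ∀ s ∈ S, ∃ p ∈ G s, dist p (n s) ≤ δ)
    (A : Finset X) (hA : A ⊆ S) :
    ∃ G' : X → Set X, Good C (L + A.card * κ) G' ∧
      Near C (A.card * (2 * ((1 + κ) * r / κ))) G G' ∧ (∀ s ∈ S, s ∉ A → G' s = G s) ∧
      ∀ s ∈ A, n s ∈ G' s ∧ ∀ p ∈ G' s, p = n s ∨ (p ∈ G s ∧ δ ≤ dist p (n s)) := by
  classical
  induction A using Finset.induction_on with
  | empty =>
    refine ⟨G, by simpa using hG, ?_, fun _ _ _ => rfl, by simp⟩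
    intro x hx
    exact ⟨fun p hp => ⟨p, hp, by simp⟩, fun p hp => ⟨p, hp, by simp⟩⟩
  | insert a A haA ih =>
    obtain ⟨G', h1, h2, h3, h4⟩ := ih ((Finset.subset_insert _ _).trans hA)
    have haS : a ∈ S := hA (Finset.mem_insert_self _ _)
    obtain ⟨b, hb, hbd⟩ := hnear a haS
    rw [← h3 a haS haA] at hb
    have hcard : ((insert a A).card : ℝ) = A.card + 1 := by
      rw [Finset.card_insert_of_notMem haA]; push_cast; ring
    have hle : ((insert a A).card : ℝ) ≤ S.card := by exact_mod_cast Finset.card_le_card hA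
    have hle2 := mul_le_mul_of_nonneg_right hle hκ.le
    rw [hcard] at hle2
    obtain ⟨G2, g1, g2, g3, g4, g5⟩ := local_mod hC h1 (by positivity) hκ (by linarith) hr hδ hδr
      (hSC a haS) (hSC _ (hn a haS)) hb hbd
    refine ⟨G2, ?_, ?_, ?_, ?_⟩
    · rw [hcard, show L + ((A.card : ℝ) + 1) * κ = L + A.card * κ + κ by ring]; exact g1
    · rw [hcard, add_mul, one_mul]; exact h2.trans g2
    · intro s hs hsA
      rw [Finset.mem_insert, not_or] at hsA
      rw [g3 s (hsep s hs a haS hsA.1), h3 s hs hsA.2]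
    · intro s hs
      rcases Finset.mem_insert.1 hs with rfl | hs'
      · rw [h3 s haS haA] at g5
        exact ⟨g4, g5⟩
      · have : s ≠ a := by rintro rfl; exact haA hs'
        rw [g3 s (hsep s (hA hs) a haS this)]
        exact h4 s hs'

lemma dense_step {C : Set X} (hC : Convex ℝ C) {F : X → Set X} (hF : Good C 1 F) {D : ℝ}
    (hD0 : 0 ≤ D) (hD : ∀ x ∈ C, ∀ y ∈ C, dist x y ≤ D) {ε : ℝ} (hε : 0 < ε) {x₀ : X}
    (hx₀ : x₀ ∈ C) : ∃ (G : X → Set X) (L δ : ℝ) (S : Finset X) (n : X → X) (N : ℕ),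
      Good C L G ∧ 0 ≤ L ∧ L < 1 ∧ 0 < δ ∧ Near C ε F G ∧ x₀ ∈ S ∧ (∀ s ∈ S, s ∈ C) ∧
      (∀ s ∈ S, n s ∈ S) ∧ (∀ k ≥ N, n^[k] x₀ = n^[N] x₀) ∧
      ∀ s ∈ S, n s ∈ G s ∧ ∀ p ∈ G s, p = n s ∨ dist s (n s) + δ ≤ dist s p := by
  obtain ⟨L, hL0, hL1, F₁, hF₁, hN₁⟩ := good_contract hC hF hD0 hD (show 0 < ε / 4 by linarith) hx₀
  obtain ⟨S, n, N, L', hxS, hSC, hnS, hN, hL'0, hL'1, hG⟩ :=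
    fatten hC hF₁ hL0 hL1 (show 0 < ε / 12 by linarith) hx₀
  set m : ℝ := (S.card : ℝ) with hm
  have hm0 : 0 ≤ m := by positivity
  set κ := (1 - L') / (m + 1) with hκd
  have hκ : 0 < κ := div_pos (by linarith) (by linarith)
  have hκm : κ * (m + 1) = 1 - L' := by rw [hκd]; field_simp
  have hev : ∀ᶠ ρ in nhdsWithin (0:ℝ) (Ioi 0), ∀ s ∈ S, ∀ t ∈ S, s ≠ t → ρ ≤ dist s t := by
    rw [Filter.eventually_all_finset]
    intro s _
    rw [Filter.eventually_all_finset]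
    intro t _
    by_cases h : s = t
    · exact Eventually.of_forall fun _ h' => absurd h h'
    · have h0 : 0 < dist s t := dist_pos.2 h
      have : ∀ᶠ ρ in nhdsWithin (0:ℝ) (Ioi 0), ρ < dist s t :=
        (gt_mem_nhds h0).filter_mono nhdsWithin_le_nhds
      exact this.mono fun ρ h' _ => h'.le
  have hev2 : ∀ᶠ ρ in nhdsWithin (0:ℝ) (Ioi 0), ρ < ε / 2 / (2 * m + 1) :=
    (gt_mem_nhds (by positivity)).filter_mono nhdsWithin_le_nhds
  obtain ⟨R, ⟨hsep, hRε⟩, hR0⟩ := ((hev.and hev2).and self_mem_nhdsWithin).exists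
  have hR0 : 0 < R := hR0
  rw [lt_div_iff₀ (by positivity)] at hRε
  set r := R * κ / (1 + κ) with hr
  have hr0 : 0 < r := by positivity
  have hRr : (1 + κ) * r / κ = R := by rw [hr]; field_simp
  obtain ⟨δ, hδ0, hδ1, G, hG1, hG2, hG3⟩ := hG (κ * r) (by positivity)
  obtain ⟨G', g1, g2, g3, g4⟩ := sharpen hC hG1 hL'0 hκ hr0 hδ0 hδ1 S hSC n hnS
    (by rw [hRr]; exact hsep) (by rw [← hm]; nlinarith) (fun s hs => (hG3 s hs).1) S subset_rfl
  rw [hRr, ← hm] at g2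
  rw [← hm] at g1
  refine ⟨G', L' + m * κ, δ, S, n, N, g1, by positivity, by nlinarith, hδ0, ?_, hxS, hSC, hnS, hN, ?_⟩
  · refine ((hN₁.trans hG2).trans g2).mono ?_
    nlinarith
  · intro s hs
    refine ⟨(g4 s hs).1, fun p hp => ?_⟩
    rcases (g4 s hs).2 p hp with h | ⟨h, h'⟩
    · exact Or.inl h
    · exact Or.inr ((hG3 s hs).2 p h h')

/-- trajectory condition for a plain set-valued map -/
def Traj (F : X → Set X) (x₀ : X) (x : ℕ → X) : Prop :=
  x 0 = x₀ ∧ ∀ k, x (k+1) ∈ F (x k) ∧ ∀ p ∈ F (x k), dist (x k) (x (k+1)) ≤ dist (x k) p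

lemma stability {C : Set X} {F G : X → Set X} {L δ ρ : ℝ} {S : Finset X} {n : X → X} {x₀ : X}
    (hG : Good C L G) (hL0 : 0 ≤ L) (hL1 : L < 1) (hxS : x₀ ∈ S) (hSC : ∀ s ∈ S, s ∈ C)
    (hnS : ∀ s ∈ S, n s ∈ S)
    (hS : ∀ s ∈ S, n s ∈ G s ∧ ∀ p ∈ G s, p = n s ∨ dist s (n s) + δ ≤ dist s p)
    (hρ : 0 < ρ) (hρδ : ρ < δ / 4) (hFG : Near C ((1 - L) * ρ) F G)
    {x : ℕ → X} (hxC : ∀ k, x k ∈ C) (hx : Traj F x₀ x) (k : ℕ) :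
    dist (x k) (n^[k] x₀) ≤ ρ ∧ n^[k] x₀ ∈ S := by
  induction k with
  | zero => rw [hx.1]; simpa using ⟨hρ.le, hxS⟩
  | succ k ih =>
    obtain ⟨ih, hs⟩ := ih
    rw [Function.iterate_succ_apply']
    set s := n^[k] x₀ with hsd
    refine ⟨?_, hnS s hs⟩
    have hLd := mul_le_mul_of_nonneg_left ih hL0
    -- the chosen point is close to a point of G s
    obtain ⟨q, hq, hqd⟩ := (hFG _ (hxC k)).1 _ (hx.2 k).1
    obtain ⟨z, hz, hzd⟩ := (hG _ (hxC k)).2.2.2 s (hSC s hs) q hq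
    have h1 : dist (x (k+1)) z ≤ ρ := (dist_triangle _ q _).trans (by linarith)
    -- a competitor
    obtain ⟨q', hq', hqd'⟩ := (hG s (hSC s hs)).2.2.2 _ (hxC k) _ (hS s hs).1
    obtain ⟨p', hp', hpd'⟩ := (hFG _ (hxC k)).2 _ hq'
    rw [dist_comm s] at hqd'
    have h2 : dist (n s) p' ≤ ρ := (dist_triangle _ q' _).trans (by
      rw [dist_comm q' p']; linarith)
    have h3 := (hx.2 k).2 p' hp'
    rcases (hS s hs).2 z hz with rfl | h
    · exact h1
    · exfalso
      have i1 := dist_triangle4 s (x k) (x (k+1)) z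
      have i2 := dist_triangle4 (x k) s (n s) p'
      rw [dist_comm s (x k)] at i1
      linarith
end helpers

section helpers
variable {X : Type*} [NormedAddCommGroup X] [NormedSpace ℝ X]

lemma nc_exists (A B : NonemptyCompacts X) {p : X} (hp : p ∈ (A : Set X)) :
    ∃ q ∈ (B : Set X), dist p q ≤ dist A B := by
  obtain ⟨q, hq, h⟩ := B.isCompact.exists_infDist_eq_dist B.nonempty p
  refine ⟨q, hq, ?_⟩
  rw [← h, NonemptyCompacts.dist_eq]
  exact infDist_le_hausdorffDist_of_mem hp
    (hausdorffEDist_ne_top_of_nonempty_of_bounded A.nonempty B.nonempty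
      A.isCompact.isBounded B.isCompact.isBounded)

lemma nc_dist_le (A B : NonemptyCompacts X) {r : ℝ} (hr : 0 ≤ r)
    (h1 : ∀ p ∈ (A : Set X), ∃ q ∈ (B : Set X), dist p q ≤ r)
    (h2 : ∀ q ∈ (B : Set X), ∃ p ∈ (A : Set X), dist p q ≤ r) : dist A B ≤ r := by
  rw [NonemptyCompacts.dist_eq]
  apply hausdorffDist_le_of_mem_dist hr h1
  intro q hq
  obtain ⟨p, hp, h⟩ := h2 q hq
  exact ⟨p, hp, by rw [dist_comm]; exact h⟩

open Classical in
/-- plain set-valued map of an element of `MSet C` -/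
noncomputable def toMap {C : Set X} (F : MSet C) (x : X) : Set X :=
  if h : x ∈ C then (F.1 ⟨x, h⟩ : Set X) else ∅

lemma toMap_eq {C : Set X} (F : MSet C) (x : C) : toMap F x = (F.1 x : Set X) := by
  rw [toMap, dif_pos x.2]

lemma toMap_good {C : Set X} (F : MSet C) : Good C 1 (toMap F) := by
  intro x hx
  rw [toMap_eq F ⟨x, hx⟩]
  refine ⟨(F.1 ⟨x, hx⟩).isCompact, (F.1 ⟨x, hx⟩).nonempty, F.2.1 _, fun y hy p hp => ?_⟩
  rw [toMap_eq F ⟨y, hy⟩]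
  obtain ⟨q, hq, h⟩ := nc_exists _ (F.1 ⟨y, hy⟩) hp
  refine ⟨q, hq, ?_⟩
  have := F.2.2 ⟨x, hx⟩ ⟨y, hy⟩
  rw [one_mul]; exact h.trans this

lemma toMap_near {C : Set X} (F G : MSet C) {r : ℝ} (h : dist F G ≤ r) :
    Near C r (toMap F) (toMap G) := by
  intro x hx
  rw [toMap_eq F ⟨x, hx⟩, toMap_eq G ⟨x, hx⟩]
  have h1 : dist (F.1 ⟨x, hx⟩) (G.1 ⟨x, hx⟩) ≤ r := (dist_coe_le_dist _).trans h
  constructor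
  · intro p hp
    obtain ⟨q, hq, h2⟩ := nc_exists _ (G.1 ⟨x, hx⟩) hp
    exact ⟨q, hq, h2.trans h1⟩
  · intro p hp
    obtain ⟨q, hq, h2⟩ := nc_exists _ (F.1 ⟨x, hx⟩) hp
    refine ⟨q, hq, ?_⟩
    rw [dist_comm q p]
    rw [dist_comm (G.1 ⟨x, hx⟩)] at h2
    exact h2.trans h1

lemma fromMap {C : Set X} {G : X → Set X} {L D : ℝ} (hG : Good C L G) (hL0 : 0 ≤ L) (hL1 : L ≤ 1)
    (hD : ∀ x ∈ C, ∀ y ∈ C, dist x y ≤ D) :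
    ∃ G' : MSet C, ∀ x ∈ C, toMap G' x = G x := by
  let g : C → NonemptyCompacts X := fun x => ⟨⟨G x, (hG x x.2).1⟩, (hG x x.2).2.1⟩
  have hg : ∀ x y, dist (g x) (g y) ≤ dist (x : X) (y : X) := by
    intro x y
    have hle : L * dist (x : X) (y : X) ≤ dist (x : X) y := mul_le_of_le_one_left dist_nonneg hL1
    apply nc_dist_le _ _ dist_nonneg
    · intro p hp
      obtain ⟨q, hq, h⟩ := (hG x x.2).2.2.2 y y.2 p hp
      exact ⟨q, hq, h.trans hle⟩
    · intro p hp
      obtain ⟨q, hq, h⟩ := (hG y y.2).2.2.2 x x.2 p hp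
      refine ⟨q, hq, ?_⟩
      rw [dist_comm (y : X) x] at h
      rw [dist_comm q p]; exact h.trans hle
  have hgc : Continuous g := by
    apply (LipschitzWith.of_dist_le_mul (K := 1) _).continuous
    intro x y
    rw [NNReal.coe_one, one_mul]; exact hg x y
  let g' : C →ᵇ NonemptyCompacts X := ⟨⟨g, hgc⟩, ⟨D, fun x y => (hg x y).trans (hD x x.2 y y.2)⟩⟩
  refine ⟨⟨g', fun x => (hG x x.2).2.2.1, hg⟩, fun x hx => ?_⟩
  exact toMap_eq _ ⟨x, hx⟩

/-- the approximating sets -/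
def UU {C : Set X} (x₀ : X) (m : ℕ) : Set (MSet C) :=
  {F | ∃ (s : ℕ → X) (N : ℕ), (∀ k ≥ N, s k = s N) ∧ ∀ x : ℕ → X, (∀ k, x k ∈ C) →
    Traj (toMap F) x₀ x → ∀ k, dist (x k) (s k) ≤ 1 / ((m : ℝ) + 1)}

lemma UU_dense {C : Set X} (hC : Convex ℝ C) (hb : Bornology.IsBounded C) {x₀ : X} (hx₀ : x₀ ∈ C)
    (m : ℕ) : Dense (interior (UU (C := C) x₀ m)) := by
  rw [Metric.dense_iff]
  intro F ε hε
  have hD : ∀ x ∈ C, ∀ y ∈ C, dist x y ≤ diam C := fun x hx y hy => dist_le_diam_of_mem hb hx hy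
  obtain ⟨G, L, δ, S, n, N, hG, hL0, hL1, hδ, hFG, hxS, hSC, hnS, hN, hS⟩ :=
    dense_step hC (toMap_good F) diam_nonneg hD (show 0 < ε / 2 by linarith) hx₀
  obtain ⟨G', hG'⟩ := fromMap hG hL0 hL1.le hD
  have hGG : Good C L (toMap G') := by
    intro x hx
    rw [hG' x hx]
    obtain ⟨h1, h2, h3, h4⟩ := hG x hx
    refine ⟨h1, h2, h3, fun y hy => ?_⟩
    rw [hG' y hy]; exact h4 y hy
  refine ⟨G', ?_, ?_⟩
  · rw [mem_ball]
    refine lt_of_le_of_lt ?_ (show ε / 2 < ε by linarith)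
    rw [dist_comm]
    refine (BoundedContinuousFunction.dist_le (by linarith)).2 fun x => ?_
    obtain ⟨h1, h2⟩ := hFG x x.2
    rw [← hG' x x.2, toMap_eq, toMap_eq] at h1 h2
    exact nc_dist_le _ _ (by linarith) h1 h2
  · rw [mem_interior_iff_mem_nhds, Metric.mem_nhds_iff]
    set ρ := min (δ / 8) (1 / ((m : ℝ) + 1)) with hρ
    have hρ0 : 0 < ρ := lt_min (by linarith) (by positivity)
    have hρδ : ρ < δ / 4 := (min_le_left _ _).trans_lt (by linarith)
    refine ⟨(1 - L) * ρ, mul_pos (by linarith) hρ0, fun H hH => ?_⟩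
    refine ⟨fun k => n^[k] x₀, N, hN, fun x hxC hx k => ?_⟩
    have := stability hGG hL0 hL1 hxS hSC hnS (by
      intro s hs; rw [hG' s (hSC s hs)]; exact hS s hs) hρ0 hρδ
      (toMap_near H G' (mem_ball.1 hH).le) hxC hx k
    exact this.1.trans (min_le_right _ _)

end helpers

/-- For every `x₀ ∈ C` there is a residual set `𝓕 ⊆ 𝓜` such that
every `F ∈ 𝓕` admits a regular trajectory `(x_k)` starting at `x₀` (i.e. `x_0 = x₀`
and `P_{F(x_k)}(x_k) = {x_{k+1}}` is a singleton for all `k`) which converges to a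
fixed point `x*` of `F`, i.e. `x* ∈ F(x*)`. -/
theorem regular_trajectory_converges_to_fixed_point
    {X : Type*} [NormedAddCommGroup X] [NormedSpace ℝ X] [CompleteSpace X]
    (C : Set X) (hCne : C.Nonempty) (hCcl : IsClosed C)
    (hCbd : Bornology.IsBounded C) (hCcv : Convex ℝ C)
    (x₀ : X) (hx₀ : x₀ ∈ C) :
    ∃ 𝓕 ∈ residual ↥(MSet C), ∀ F ∈ 𝓕,
      ∃ x : ℕ → C, (x 0 : X) = x₀ ∧
        (∀ k : ℕ, projSet (F.1 (x k) : Set X) (x k) = {(x (k + 1) : X)}) ∧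
        ∃ xstar : C, Tendsto (fun k => (x k : X)) atTop (nhds (xstar : X)) ∧
          (xstar : X) ∈ (F.1 xstar : Set X) := by
  have hU : ∀ m : ℕ, UU (C := C) x₀ m ∈ residual ↥(MSet C) := fun m =>
    mem_of_superset (residual_of_dense_open isOpen_interior (UU_dense hCcv hCbd hx₀ m))
      interior_subset
  refine ⟨⋂ m, UU (C := C) x₀ m, countable_iInter_mem.2 hU, fun F hF => ?_⟩
  rw [mem_iInter] at hF
  have hgood := toMap_good F
  have hT : ∀ x : X, ∃ z, x ∈ C → z ∈ toMap F x ∧ ∀ q ∈ toMap F x, dist x z ≤ dist x q := by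
    intro x
    by_cases hx : x ∈ C
    · obtain ⟨p, hp, h⟩ := (hgood x hx).1.exists_isMinOn (hgood x hx).2.1
        (f := fun q => dist x q) (by fun_prop)
      exact ⟨p, fun _ => ⟨hp, fun q hq => h hq⟩⟩
    · exact ⟨x, fun h => absurd h hx⟩
  choose T hT using hT
  have hTC : ∀ x ∈ C, T x ∈ C := fun x hx => (hgood x hx).2.2.1 (hT x hx).1
  have horb : ∀ b ∈ C, ∀ k, T^[k] b ∈ C := by
    intro b hb k
    induction k with
    | zero => exact hb
    | succ k ih => rw [Function.iterate_succ_apply']; exact hTC _ ih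
  set x : ℕ → X := fun k => T^[k] x₀ with hxd
  have hxs : ∀ k, x (k+1) = T (x k) := fun k => Function.iterate_succ_apply' T k x₀
  have hxC : ∀ k, x k ∈ C := horb x₀ hx₀
  have hxT : Traj (toMap F) x₀ x := by
    refine ⟨rfl, fun k => ?_⟩
    rw [hxs]; exact hT _ (hxC k)
  have huniq : ∀ k b, b ∈ toMap F (x k) → (∀ p ∈ toMap F (x k), dist (x k) b ≤ dist (x k) p) →
      b = x (k+1) := by
    intro k b hb hbm
    have hbC : b ∈ C := (hgood _ (hxC k)).2.2.1 hb
    set x' : ℕ → X := fun l => if l ≤ k then x l else T^[l - (k+1)] b with hx'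
    have hx'C : ∀ l, x' l ∈ C := by
      intro l
      simp only [hx']
      split_ifs
      exacts [hxC l, horb b hbC _]
    have hx'1 : x' (k+1) = b := by simp [hx']
    have hx'T : Traj (toMap F) x₀ x' := by
      refine ⟨by simp [hx', hxd], fun l => ?_⟩
      rcases lt_trichotomy l k with h | rfl | h
      · have e1 : x' l = x l := if_pos h.le
        have e2 : x' (l+1) = x (l+1) := if_pos (by omega)
        rw [e1, e2]; exact hxT.2 l
      · have e1 : x' l = x l := if_pos le_rfl
        rw [e1, hx'1]; exact ⟨hb, hbm⟩
      · have e1 : x' (l+1) = T (x' l) := by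
          have a1 : x' l = T^[l - (k+1)] b := if_neg (by omega)
          have a2 : x' (l+1) = T^[l + 1 - (k+1)] b := if_neg (by omega)
          rw [a1, a2, show l + 1 - (k + 1) = (l - (k+1)) + 1 by omega,
            Function.iterate_succ_apply']
        rw [e1]; exact hT _ (hx'C l)
    have hd : ∀ m : ℕ, dist b (x (k+1)) ≤ 2 * (1 / ((m : ℝ) + 1)) := by
      intro m
      obtain ⟨s, N, -, hs⟩ := hF m
      have h1 := hs x hxC hxT (k+1)
      have h2 := hs x' hx'C hx'T (k+1)
      rw [hx'1] at h2
      have := dist_triangle_right b (x (k+1)) (s (k+1))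
      linarith
    have hlim : Tendsto (fun m : ℕ => 2 * (1 / ((m : ℝ) + 1))) atTop (nhds 0) := by
      simpa using tendsto_one_div_add_atTop_nhds_zero_nat.const_mul (2 : ℝ)
    have := ge_of_tendsto' hlim hd
    exact dist_le_zero.1 this
  have hcau : CauchySeq x := by
    rw [Metric.cauchySeq_iff']
    intro ε hε
    obtain ⟨m, hm⟩ := exists_nat_one_div_lt (show 0 < ε / 2 by linarith)
    obtain ⟨s, N, hN, hs⟩ := hF m
    refine ⟨N, fun k hk => ?_⟩
    have h1 := hs x hxC hxT k
    have h2 := hs x hxC hxT N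
    rw [hN k hk] at h1
    have := dist_triangle_right (x k) (x N) (s N)
    linarith
  obtain ⟨z, hz⟩ := cauchySeq_tendsto_of_complete hcau
  have hzC : z ∈ C := hCcl.mem_of_tendsto hz (Eventually.of_forall hxC)
  refine ⟨fun k => ⟨x k, hxC k⟩, rfl, fun k => ?_, ⟨z, hzC⟩, hz, ?_⟩
  · have e1 := toMap_eq F ⟨x k, hxC k⟩
    simp only at e1
    rw [← e1]
    have hmin : ∀ y ∈ toMap F (x k), (dist (x k) y = infDist (x k) (toMap F (x k)) ↔
        ∀ p ∈ toMap F (x k), dist (x k) y ≤ dist (x k) p) := by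
      intro y hy
      constructor
      · intro h p hp
        rw [h]; exact infDist_le_dist_of_mem hp
      · intro h
        exact le_antisymm ((le_infDist ⟨y, hy⟩).2 fun {p} hp => h p hp) (infDist_le_dist_of_mem hy)
    ext y
    simp only [projSet, mem_sep_iff, mem_singleton_iff]
    constructor
    · rintro ⟨hy, h⟩
      exact huniq k y hy ((hmin y hy).1 h)
    · rintro rfl
      exact ⟨(hxT.2 k).1, (hmin _ (hxT.2 k).1).2 (hxT.2 k).2⟩
  · have e1 := toMap_eq F ⟨z, hzC⟩
    simp only at e1
    rw [← e1]
    obtain ⟨h1, h2, -, -⟩ := hgood z hzC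
    rw [h1.isClosed.mem_iff_infDist_zero h2]
    refine le_antisymm ?_ infDist_nonneg
    have hlim : Tendsto (fun k => dist z (x (k+1)) + dist (x k) z) atTop (nhds 0) := by
      have a1 : Tendsto (fun k => dist (x k) z) atTop (nhds 0) := tendsto_iff_dist_tendsto_zero.1 hz
      have a2 : Tendsto (fun k => dist z (x (k+1))) atTop (nhds 0) := by
        simp_rw [dist_comm z]
        exact a1.comp (tendsto_add_atTop_nat 1)
      simpa using a2.add a1
    refine ge_of_tendsto' hlim fun k => ?_
    obtain ⟨q, hq, hd⟩ := (hgood _ (hxC k)).2.2.2 z hzC _ (hxT.2 k).1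
    rw [one_mul] at hd
    exact (infDist_le_dist_of_mem hq).trans ((dist_triangle z (x (k+1)) q).trans (by linarith))
end

section
/- Let X be a separable Banach space and C ⊆ X a nonempty, closed, bounded and convex subset. Then there is a residual set 𝓕 in the metric space (𝓜, ρ) such that for every F ∈ 𝓕 there exists a residual subset 𝓤 ⊆ C (with respect to the metric topology of C) with the following property: for every x₀ ∈ 𝓤 the map F admits a regular trajectory starting at x₀, i.e. there is a sequence (x_k)_{k≥0} with x_0 = x₀ and P_{F(x_k)}(x_k) = {x_{k+1}} a singleton for all k ≥ 0. -/
open Metric Set TopologicalSpace BoundedContinuousFunction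

/-- Points reachable by trajectories in exactly `n` steps. -/
def reachS {X : Type*} [NormedAddCommGroup X] {C : Set X} (F : MSet C) (x : C) : ℕ → Set C
  | 0 => {x}
  | n + 1 => {w | ∃ v ∈ reachS F x n, (w : X) ∈ projSet (F.1 v : Set X) v}

lemma exists_near {X : Type*} [NormedAddCommGroup X] (A B : NonemptyCompacts X) (z : X)
    (hz : z ∈ (A : Set X)) : ∃ w ∈ (B : Set X), dist z w ≤ dist A B := by
  obtain ⟨w, hw, h⟩ := B.isCompact.exists_infDist_eq_dist B.nonempty z
  refine ⟨w, hw, ?_⟩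
  rw [← h, NonemptyCompacts.dist_eq]
  exact infDist_le_hausdorffDist_of_mem hz
    (hausdorffEDist_ne_top_of_nonempty_of_bounded A.nonempty B.nonempty
      A.isCompact.isBounded B.isCompact.isBounded)

lemma proj_nonempty {X : Type*} [NormedAddCommGroup X] (A : NonemptyCompacts X) (x : X) :
    (projSet (A : Set X) x).Nonempty := by
  obtain ⟨w, hw, h⟩ := A.isCompact.exists_infDist_eq_dist A.nonempty x
  exact ⟨w, hw, h.symm⟩

lemma mk_map {X : Type*} [NormedAddCommGroup X] {C : Set X}
    (hCbd : Bornology.IsBounded C) (F : MSet C) (L L' a b δ : ℝ)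
    (hF : ∀ x y : C, dist (F.1 x) (F.1 y) ≤ L * dist x y)
    (φ : C → X → X) (hφ : ∀ x, ∀ z ∈ C, φ x z ∈ C) (ha : 0 ≤ a) (hb : 0 ≤ b) (hδ : 0 ≤ δ)
    (hL0 : 0 ≤ L)
    (hLip : ∀ x y : C, ∀ z ∈ C, ∀ w ∈ C, dist (φ x z) (φ y w) ≤ a * dist x y + b * dist z w)
    (hd : ∀ x, ∀ z ∈ C, dist (φ x z) z ≤ δ) (hL' : a + b * L ≤ L') (hL1 : L' ≤ 1) :
    ∃ G : MSet C, (∀ x, (G.1 x : Set X) = φ x '' (F.1 x : Set X)) ∧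
      (∀ x y : C, dist (G.1 x) (G.1 y) ≤ L' * dist x y) ∧ dist G F ≤ δ := by
  have hsub : ∀ x : C, (F.1 x : Set X) ⊆ C := F.2.1
  have hcont : ∀ x : C, ContinuousOn (φ x) (F.1 x : Set X) := by
    intro x
    have : LipschitzOnWith b.toNNReal (φ x) (F.1 x : Set X) :=
      LipschitzOnWith.of_dist_le_mul fun z hz w hw => by
        have := hLip x x z (hsub x hz) w (hsub x hw)
        simpa [Real.coe_toNNReal b hb] using this
    exact this.continuousOn
  let g : C → NonemptyCompacts X := fun x =>
    ⟨⟨φ x '' (F.1 x : Set X), (F.1 x).isCompact.image_of_continuousOn (hcont x)⟩,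
      (F.1 x).nonempty.image _⟩
  have hg : ∀ x, (g x : Set X) = φ x '' (F.1 x : Set X) := fun x => rfl
  have key : ∀ x y : C, ∀ u ∈ (g x : Set X), ∃ v ∈ (g y : Set X), dist u v ≤ L' * dist x y := by
    rintro x y u ⟨z, hz, rfl⟩
    obtain ⟨w, hw, h⟩ := exists_near _ (F.1 y) z hz
    refine ⟨_, ⟨w, hw, rfl⟩, ?_⟩
    have h1 := hLip x y z (hsub x hz) w (hsub y hw)
    have h2 : dist z w ≤ L * dist x y := h.trans (hF x y)
    have h3 := mul_le_mul_of_nonneg_left h2 hb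
    have h4 := mul_le_mul_of_nonneg_right hL' (dist_nonneg (x := x) (y := y))
    nlinarith
  have hL'0 : 0 ≤ L' := le_trans (by positivity) hL'
  have hgL : ∀ x y : C, dist (g x) (g y) ≤ L' * dist x y := by
    intro x y
    rw [NonemptyCompacts.dist_eq]
    refine hausdorffDist_le_of_mem_dist (by positivity) (key x y) ?_
    intro u hu
    rw [dist_comm x y]
    exact key y x u hu
  have hgc : Continuous g :=
    (LipschitzWith.of_dist_le_mul (K := ⟨L', hL'0⟩) hgL).continuous
  obtain ⟨D, hD⟩ := Metric.isBounded_iff.1 hCbd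
  let G : C →ᵇ NonemptyCompacts X := BoundedContinuousFunction.mkOfBound ⟨g, hgc⟩ (L' * D) (by
    intro x y
    exact (hgL x y).trans (mul_le_mul_of_nonneg_left (hD x.2 y.2) hL'0))
  refine ⟨⟨G, ⟨?_, ?_⟩⟩, hg, hgL, ?_⟩
  · rintro x _ ⟨z, hz, rfl⟩
    exact hφ x z (hsub x hz)
  · intro x y
    refine (hgL x y).trans ?_
    exact (mul_le_mul_of_nonneg_right hL1 dist_nonneg).trans (one_mul _).le
  · rw [Subtype.dist_eq, BoundedContinuousFunction.dist_le hδ]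
    intro x
    rw [NonemptyCompacts.dist_eq]
    refine hausdorffDist_le_of_mem_dist hδ ?_ ?_
    · rintro _ ⟨z, hz, rfl⟩
      exact ⟨z, hz, hd x z (hsub x hz)⟩
    · intro z hz
      exact ⟨_, ⟨z, hz, rfl⟩, by rw [dist_comm]; exact hd x z (hsub x hz)⟩

lemma usc_step {X : Type*} [NormedAddCommGroup X] {C : Set X} (F : MSet C) (x z : C)
    (h : projSet (F.1 x : Set X) x = {(z : X)}) (ε : ℝ) (hε : 0 < ε) :
    ∃ δ > 0, ∀ (G : MSet C) (y : C), dist G F < δ → dist y x < δ →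
      ∀ w ∈ projSet (G.1 y : Set X) y, dist w z < ε := by
  obtain ⟨γ, hγ, hK⟩ : ∃ γ > 0, ∀ v ∈ (F.1 x : Set X),
      dist (x : X) v < infDist (x : X) (F.1 x : Set X) + γ → dist v z < ε / 2 := by
    set K : Set X := (F.1 x : Set X) \ ball (z : X) (ε / 2) with hKdef
    have hKc : IsCompact K := (F.1 x).isCompact.diff isOpen_ball
    rcases K.eq_empty_or_nonempty with hK | hK
    · refine ⟨1, one_pos, fun v hv _ => ?_⟩
      by_contra hcon
      have : v ∈ K := ⟨hv, hcon⟩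
      rw [hK] at this
      exact this
    · obtain ⟨u, hu, hud⟩ := hKc.exists_infDist_eq_dist hK (x : X)
      have hlt : infDist (x : X) (F.1 x : Set X) < dist (x : X) u := by
        refine lt_of_le_of_ne (infDist_le_dist_of_mem hu.1) fun he => ?_
        have : u ∈ projSet (F.1 x : Set X) x := ⟨hu.1, he.symm⟩
        rw [h] at this
        apply hu.2
        rw [mem_singleton_iff.1 this]
        exact mem_ball_self (by linarith)
      refine ⟨dist (x : X) u - infDist (x : X) (F.1 x : Set X), by linarith, fun v hv hlt' => ?_⟩
      by_contra hcon
      have : v ∈ K := ⟨hv, hcon⟩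
      have := infDist_le_dist_of_mem (x := (x : X)) this
      linarith
  refine ⟨min (ε / 8) (γ / 8), by positivity, fun G y hG hy w hw => ?_⟩
  set δ := min (ε / 8) (γ / 8) with hδ
  have hδ1 : δ ≤ ε / 8 := min_le_left _ _
  have hδ2 : δ ≤ γ / 8 := min_le_right _ _
  have hyx : dist (y : X) x < δ := hy
  have hGF : dist (G.1 y) (F.1 x) < 2 * δ := by
    have h1 : dist (G.1 y) (F.1 y) ≤ dist G F := BoundedContinuousFunction.dist_coe_le_dist y
    have h2 := F.2.2 y x
    have h3 := dist_triangle (G.1 y) (F.1 y) (F.1 x)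
    linarith
  obtain ⟨v, hv, hwv⟩ := exists_near _ (F.1 x) w hw.1
  obtain ⟨p, hp, hpd⟩ := (F.1 x).isCompact.exists_infDist_eq_dist (F.1 x).nonempty (x : X)
  obtain ⟨q, hq, hpq⟩ := exists_near _ (G.1 y) p hp
  rw [dist_comm (F.1 x)] at hpq
  have h1 : dist (y : X) w ≤ dist (y : X) q := by
    rw [hw.2]; exact infDist_le_dist_of_mem hq
  have h2 := dist_triangle4 (y : X) x p q
  have h3 := dist_triangle4 (x : X) y w v
  rw [dist_comm (x : X) y] at h3
  have h4 := hK v hv (by linarith)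
  have h5 := dist_triangle w v z
  linarith

lemma usc_reach {X : Type*} [NormedAddCommGroup X] {C : Set X} (F : MSet C) (s : ℕ → C) (n : ℕ)
    (h : ∀ k < n, projSet (F.1 (s k) : Set X) (s k) = {(s (k + 1) : X)}) :
    ∀ ε > 0, ∃ δ > 0, ∀ (G : MSet C) (y : C), dist G F < δ → dist y (s 0) < δ →
      ∀ w ∈ reachS G y n, dist w (s n) < ε := by
  induction n with
  | zero =>
    intro ε hε
    refine ⟨ε, hε, fun G y _ hy w hw => ?_⟩
    have : w = y := hw
    rwa [this]
  | succ n ih =>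
    intro ε hε
    obtain ⟨δ₁, h₁, H₁⟩ := usc_step F (s n) (s (n + 1)) (h n (by omega)) ε hε
    obtain ⟨δ₂, h₂, H₂⟩ := ih (fun k hk => h k (by omega)) δ₁ h₁
    refine ⟨min δ₁ δ₂, lt_min h₁ h₂, fun G y hG hy w hw => ?_⟩
    obtain ⟨v, hv, hwv⟩ := hw
    exact H₁ G v (hG.trans_le (min_le_left _ _))
      (H₂ G y (hG.trans_le (min_le_right _ _)) (hy.trans_le (min_le_right _ _)) v hv) w hwv

lemma contract {X : Type*} [NormedAddCommGroup X] [NormedSpace ℝ X] {C : Set X}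
    (hCbd : Bornology.IsBounded C) (hCcv : Convex ℝ C) (c : C) (F : MSet C) (ε : ℝ) (hε : 0 < ε) :
    ∃ G : MSet C, dist G F < ε ∧ ∃ L, 0 ≤ L ∧ L < 1 ∧
      ∀ x y : C, dist (G.1 x) (G.1 y) ≤ L * dist x y := by
  obtain ⟨D, hDpos, hD⟩ : ∃ D > 0, ∀ x ∈ C, ∀ y ∈ C, dist x y ≤ D := by
    obtain ⟨D, hD⟩ := Metric.isBounded_iff.1 hCbd
    exact ⟨max D 1, by positivity, fun x hx y hy => (hD hx hy).trans (le_max_left _ _)⟩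
  set t : ℝ := min 1 (ε / 2 / D) with ht
  have ht0 : 0 < t := by positivity
  have ht1 : t ≤ 1 := min_le_left _ _
  have htD : t * D ≤ ε / 2 := by
    rw [← le_div_iff₀ hDpos]; exact min_le_right _ _
  obtain ⟨G, -, hGL, hGd⟩ := mk_map hCbd F 1 (1 - t) 0 (1 - t) (ε / 2)
    (by intro x y; rw [one_mul]; exact F.2.2 x y)
    (fun _ z => z + t • ((c : X) - z))
    (fun _ z hz => hCcv.add_smul_sub_mem hz c.2 ⟨ht0.le, ht1⟩) le_rfl (by linarith) (by linarith)
    zero_le_one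
    (by
      intro _ _ z _ w _
      have : z + t • ((c : X) - z) - (w + t • ((c : X) - w)) = (1 - t) • (z - w) := by module
      rw [dist_eq_norm, this, norm_smul, Real.norm_of_nonneg (by linarith), dist_eq_norm z w]
      linarith)
    (by
      intro _ z hz
      rw [dist_eq_norm, add_sub_cancel_left, norm_smul, Real.norm_of_nonneg ht0.le, ← dist_eq_norm]
      have := hD c c.2 z hz
      nlinarith)
    (by linarith) (by linarith)
  exact ⟨G, by linarith, 1 - t, by linarith, by linarith, hGL⟩

lemma perturb {X : Type*} [NormedAddCommGroup X] [NormedSpace ℝ X] {C : Set X}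
    (hCbd : Bornology.IsBounded C) (hCcv : Convex ℝ C) (F : MSet C) (L : ℝ) (hL0 : 0 ≤ L)
    (hL1 : L < 1) (hF : ∀ x y : C, dist (F.1 x) (F.1 y) ≤ L * dist x y) (c : C) (r : ℝ)
    (hr : 0 < r) (hr1 : r ≤ 1) (ε : ℝ) (hε : 0 < ε) :
    ∃ G : MSet C, dist G F < ε ∧ (∃ L, 0 ≤ L ∧ L < 1 ∧
      ∀ x y : C, dist (G.1 x) (G.1 y) ≤ L * dist x y) ∧
      (∀ y : C, r ≤ dist y c → (G.1 y : Set X) = F.1 y) ∧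
      ∃ z : C, projSet (G.1 c : Set X) c = {(z : X)} := by
  obtain ⟨D, hDpos, hD⟩ : ∃ D > 0, ∀ x ∈ C, ∀ y ∈ C, dist x y ≤ D := by
    obtain ⟨D, hD⟩ := Metric.isBounded_iff.1 hCbd
    exact ⟨max D 1, by positivity, fun x hx y hy => (hD hx hy).trans (le_max_left _ _)⟩
  obtain ⟨p, hp, hpd⟩ := (F.1 c).isCompact.exists_infDist_eq_dist (F.1 c).nonempty (c : X)
  have hL1' : 0 < 1 - L := by linarith
  set η : ℝ := min (1 / 2) (min (ε / 2) ((1 - L) / 4) / D) with hη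
  have hη0 : 0 < η := by positivity
  have hη1 : η ≤ 1 / 2 := min_le_left _ _
  have hηD : η * D ≤ min (ε / 2) ((1 - L) / 4) := by
    rw [← le_div_iff₀ hDpos]; exact min_le_right _ _
  have hηD1 : η * D ≤ ε / 2 := hηD.trans (min_le_left _ _)
  have hηD2 : η * D ≤ (1 - L) / 4 := hηD.trans (min_le_right _ _)
  let lam : C → X → ℝ := fun y z => η * max 0 (r - dist z p - dist (y : X) c)
  have hlam0 : ∀ y z, 0 ≤ lam y z := fun y z => by positivity
  have hlamr : ∀ y z, lam y z ≤ η * r := fun y z => by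
    refine mul_le_mul_of_nonneg_left (max_le hr.le ?_) hη0.le
    have := dist_nonneg (x := z) (y := p)
    have := dist_nonneg (x := (y : X)) (y := c)
    linarith
  have hηr : η * r ≤ η := by nlinarith
  have hlamη : ∀ y z, lam y z ≤ η := fun y z => (hlamr y z).trans hηr
  have hlamL : ∀ (y y' : C) z w, |lam y z - lam y' w| ≤ η * (dist y y' + dist z w) := by
    intro y y' z w
    have e : lam y z - lam y' w = η * (max 0 (r - dist z p - dist (y : X) c)
        - max 0 (r - dist w p - dist (y' : X) c)) := by simp only [lam]; ring
    rw [e, abs_mul, abs_of_pos hη0]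
    refine mul_le_mul_of_nonneg_left ?_ hη0.le
    have h1 : |dist z p - dist w p| ≤ dist z w := abs_dist_sub_le _ _ _
    have h2 : |dist (y : X) c - dist (y' : X) c| ≤ dist y y' := abs_dist_sub_le _ _ _
    have h3 := dist_nonneg (x := z) (y := w)
    have h4 := dist_nonneg (x := y) (y := y')
    rw [abs_le] at *
    rcases max_cases 0 (r - dist z p - dist (y : X) c) with ⟨e1, _⟩ | ⟨e1, _⟩ <;>
    rcases max_cases 0 (r - dist w p - dist (y' : X) c) with ⟨e2, _⟩ | ⟨e2, _⟩ <;>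
    rw [e1, e2] <;> constructor <;> linarith
  let φ : C → X → X := fun y z => z + lam y z • ((c : X) - z)
  obtain ⟨G, hG, hGL, hGd⟩ := mk_map hCbd F L ((1 + L) / 2) (η * D) (1 + η * D) (ε / 2) hF φ
    (fun y z hz => hCcv.add_smul_sub_mem hz c.2 ⟨hlam0 y z, by linarith [hlamη y z]⟩)
    (by positivity) (by positivity) (by linarith) hL0
    (by
      intro y y' z hz w hw
      have e : φ y z - φ y' w = (1 - lam y z) • (z - w) + (lam y z - lam y' w) • ((c : X) - w) := by
        simp only [φ]; module
      have h1 : ‖(1 - lam y z) • (z - w)‖ ≤ dist z w := by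
        rw [norm_smul, Real.norm_of_nonneg (by linarith [hlamη y z]), ← dist_eq_norm]
        have := hlam0 y z
        have := dist_nonneg (x := z) (y := w)
        nlinarith
      have h2 : ‖(lam y z - lam y' w) • ((c : X) - w)‖ ≤ η * (dist y y' + dist z w) * D := by
        rw [norm_smul, Real.norm_eq_abs, ← dist_eq_norm (c : X)]
        exact mul_le_mul (hlamL y y' z w) (hD c c.2 w hw) dist_nonneg (by positivity)
      have h3 := norm_add_le ((1 - lam y z) • (z - w)) ((lam y z - lam y' w) • ((c : X) - w))
      rw [dist_eq_norm (φ y z), e]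
      nlinarith)
    (by
      intro y z hz
      simp only [φ]
      rw [dist_eq_norm, add_sub_cancel_left, norm_smul, Real.norm_of_nonneg (hlam0 y z),
        ← dist_eq_norm]
      exact (mul_le_mul (hlamη y z) (hD c c.2 z hz) dist_nonneg hη0.le).trans hηD1)
    (by nlinarith) (by linarith)
  have hdist : ∀ z, dist (c : X) (φ c z) = (1 - lam c z) * dist (c : X) z := by
    intro z
    have e : (c : X) - φ c z = (1 - lam c z) • ((c : X) - z) := by simp only [φ]; module
    rw [dist_eq_norm, e, norm_smul, Real.norm_of_nonneg (by linarith [hlamη c z]), dist_eq_norm]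
  have hlamp : lam c p = η * r := by
    simp only [lam, dist_self, sub_zero]
    rw [max_eq_right hr.le]
  have hpC : φ c p ∈ C := hCcv.add_smul_sub_mem (F.2.1 c hp) c.2 ⟨hlam0 c p, by linarith [hlamη c p]⟩
  have hmin : ∀ z ∈ (F.1 c : Set X), dist (c : X) p ≤ dist (c : X) z := fun z hz => by
    rw [← hpd]; exact infDist_le_dist_of_mem hz
  have hle : ∀ z ∈ (F.1 c : Set X), dist (c : X) (φ c p) ≤ dist (c : X) (φ c z) := by
    intro z hz
    rw [hdist, hdist, hlamp]
    exact mul_le_mul (by linarith [hlamr c z]) (hmin z hz) dist_nonneg (by linarith [hlamη c z])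
  have hinf : infDist (c : X) (G.1 c : Set X) = dist (c : X) (φ c p) := by
    refine le_antisymm (infDist_le_dist_of_mem (by rw [hG]; exact ⟨p, hp, rfl⟩)) ?_
    rw [le_infDist (G.1 c).nonempty]
    intro u hu
    rw [hG] at hu
    obtain ⟨z, hz, rfl⟩ := hu
    exact hle z hz
  refine ⟨G, by linarith, ⟨(1 + L) / 2, by linarith, by linarith, hGL⟩, ?_, ⟨φ c p, hpC⟩, ?_⟩
  · intro y hy
    have hl : ∀ z, φ y z = z := by
      intro z
      have : lam y z = 0 := by
        simp only [lam]
        have h1 : r ≤ dist (y : X) c := hy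
        have h2 := dist_nonneg (x := z) (y := p)
        rw [max_eq_left (by linarith), mul_zero]
      simp only [φ, this, zero_smul, add_zero]
    rw [hG]
    simp only [hl, image_id']
  · ext u
    simp only [mem_singleton_iff]
    constructor
    · rintro ⟨hu, hud⟩
      rw [hinf] at hud
      rw [hG] at hu
      obtain ⟨z, hz, rfl⟩ := hu
      rcases (dist_nonneg (x := (c : X)) (y := p)).eq_or_lt with h0 | h0
      · have : dist (c : X) (φ c p) = 0 := by rw [hdist, ← h0, mul_zero]
        rw [this] at hud
        rw [← dist_eq_zero.1 hud, ← dist_eq_zero.1 this]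
      · rw [hdist, hdist, hlamp] at hud
        have h1 := hmin z hz
        have h2 := hlamr c z
        have h3 : η * r ≤ lam c z := by
          by_contra hcon
          push Not at hcon
          have h4 : 0 < η * r - lam c z := by linarith
          nlinarith [mul_pos h4 h0, hlamη c z]
        have h4 : r ≤ max 0 (r - dist z p - dist (c : X) c) := le_of_mul_le_mul_left h3 hη0
        rw [dist_self, sub_zero, le_max_iff] at h4
        have h5 : dist z p = 0 := by
          have := dist_nonneg (x := z) (y := p)
          rcases h4 with h4 | h4 <;> linarith
        rw [dist_eq_zero.1 h5]
    · rintro rfl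
      exact ⟨by rw [hG]; exact ⟨p, hp, rfl⟩, hinf.symm⟩

lemma exists_sep {Y : Type*} [MetricSpace Y] (s : ℕ → Y) (c : Y) (n : ℕ)
    (h : ∀ k < n, s k ≠ c) : ∃ r : ℝ, 0 < r ∧ r ≤ 1 ∧ ∀ k < n, r ≤ dist (s k) c := by
  induction n with
  | zero => exact ⟨1, one_pos, le_rfl, fun k hk => by omega⟩
  | succ m ih =>
    obtain ⟨r, h0, h1, h2⟩ := ih fun k hk => h k (by omega)
    refine ⟨min r (dist (s m) c), lt_min h0 (dist_pos.2 (h m (by omega))),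
      (min_le_left _ _).trans h1, fun k hk => ?_⟩
    rcases Nat.lt_succ_iff_lt_or_eq.1 hk with hk | rfl
    · exact (min_le_left _ _).trans (h2 k hk)
    · exact min_le_right _ _

lemma dense_reg {X : Type*} [NormedAddCommGroup X] [NormedSpace ℝ X] {C : Set X}
    (hCbd : Bornology.IsBounded C) (hCcv : Convex ℝ C) (x : C) (n : ℕ) :
    ∀ (F : MSet C) (ε : ℝ), 0 < ε → ∃ G : MSet C, dist G F < ε ∧ (∃ L, 0 ≤ L ∧ L < 1 ∧
      ∀ x y : C, dist (G.1 x) (G.1 y) ≤ L * dist x y) ∧ ∃ s : ℕ → C, s 0 = x ∧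
        ∀ k < n, projSet (G.1 (s k) : Set X) (s k) = {(s (k + 1) : X)} := by
  induction n with
  | zero =>
    intro F ε hε
    obtain ⟨G, h1, h2⟩ := contract hCbd hCcv x F ε hε
    exact ⟨G, h1, h2, fun _ => x, rfl, fun k hk => by omega⟩
  | succ n ih =>
    intro F ε hε
    obtain ⟨F', hF', ⟨L, hL0, hL1, hL⟩, s, hs0, hs⟩ := ih F (ε / 2) (by linarith)
    have build : ∀ (G : MSet C) (z : C),
        (∀ k < n, projSet (G.1 (s k) : Set X) (s k) = {(s (k + 1) : X)}) →
        projSet (G.1 (s n) : Set X) (s n) = {(z : X)} →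
        ∃ s : ℕ → C, s 0 = x ∧
        ∀ k < n + 1, projSet (G.1 (s k) : Set X) (s k) = {(s (k + 1) : X)} := by
      intro G z h1 h2
      refine ⟨Function.update s (n + 1) z, ?_, ?_⟩
      · rw [Function.update_of_ne (by omega), hs0]
      · intro k hk
        rw [Function.update_of_ne (by omega : k ≠ n + 1)]
        rcases Nat.lt_succ_iff_lt_or_eq.1 hk with hk | rfl
        · rw [Function.update_of_ne (by omega), h1 k hk]
        · rw [Function.update_self, h2]
    by_cases hper : ∃ k < n, s k = s n
    · obtain ⟨k, hk, he⟩ := hper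
      refine ⟨F', by linarith, ⟨L, hL0, hL1, hL⟩, build F' (s (k + 1)) hs ?_⟩
      rw [← he]; exact hs k hk
    · push Not at hper
      obtain ⟨r, hr0, hr1, hr⟩ : ∃ r : ℝ, 0 < r ∧ r ≤ 1 ∧ ∀ k < n, r ≤ dist (s k) (s n) := by
        exact exists_sep s (s n) n hper
      obtain ⟨G, hG, hGL, hGe, z, hz⟩ :=
        perturb hCbd hCcv F' L hL0 hL1 hL (s n) r hr0 hr1 (ε / 2) (by linarith)
      refine ⟨G, ?_, hGL, build G z ?_ hz⟩
      · linarith [dist_triangle G F' F]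
      · intro k hk
        rw [hGe (s k) (hr k hk)]; exact hs k hk

/-- Let `X` be a separable Banach space and `C` nonempty, closed,
bounded and convex. Then there is a residual set `𝓕 ⊆ 𝓜` such that for every
`F ∈ 𝓕` there is a residual subset `𝓤 ⊆ C` such that for every `x₀ ∈ 𝓤` the map
`F` admits a regular trajectory starting at `x₀`: a sequence `(x_k)` with `x_0 = x₀`
and `P_{F(x_k)}(x_k) = {x_{k+1}}` a singleton for all `k`. -/
theorem separable_residual_set_of_initial_points
    {X : Type*} [NormedAddCommGroup X] [NormedSpace ℝ X] [CompleteSpace X]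
    [SeparableSpace X]
    (C : Set X) (hCne : C.Nonempty) (hCcl : IsClosed C)
    (hCbd : Bornology.IsBounded C) (hCcv : Convex ℝ C) :
    ∃ 𝓕 ∈ residual ↥(MSet C), ∀ F ∈ 𝓕,
      ∃ 𝓤 ∈ residual ↥C, ∀ x₀ ∈ 𝓤,
        ∃ x : ℕ → C, x 0 = x₀ ∧
          ∀ k : ℕ, projSet (F.1 (x k) : Set X) (x k) = {(x (k + 1) : X)} := by
  haveI : SecondCountableTopology X := UniformSpace.secondCountable_of_separable X
  haveI : Nonempty C := hCne.to_subtype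
  let D : ℕ → ℕ → Set (MSet C × C) := fun n m =>
    ⋃ z : C, interior {q | ∀ w ∈ reachS q.1 q.2 n, dist w z < 1 / ((m : ℝ) + 1)}
  have hDo : ∀ n m, IsOpen (D n m) := fun n m => isOpen_iUnion fun z => isOpen_interior
  have hDreg : ∀ n m (G : MSet C) (s : ℕ → C),
      (∀ k < n, projSet (G.1 (s k) : Set X) (s k) = {(s (k + 1) : X)}) → (G, s 0) ∈ D n m := by
    intro n m G s hs
    obtain ⟨δ, hδ, H⟩ := usc_reach G s n hs (1 / ((m : ℝ) + 1)) (by positivity)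
    refine mem_iUnion.2 ⟨s n, mem_interior_iff_mem_nhds.2 ?_⟩
    refine Metric.mem_nhds_iff.2 ⟨δ, hδ, ?_⟩
    rintro ⟨G', y⟩ hq
    rw [mem_ball, Prod.dist_eq, max_lt_iff] at hq
    exact H G' y hq.1 hq.2
  let q := denseSeq C
  have hq : DenseRange q := denseRange_denseSeq C
  refine ⟨⋂ i, ⋂ n, ⋂ m, {F | (F, q i) ∈ D n m}, ?_, ?_⟩
  · simp only [countable_iInter_mem]
    intro i n m
    refine residual_of_dense_open ((hDo n m).preimage (by fun_prop : Continuous fun F : MSet C => (F, q i))) ?_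
    rw [Metric.dense_iff]
    intro F ε hε
    obtain ⟨G, hG, -, s, hs0, hs⟩ := dense_reg hCbd hCcv (q i) n F ε hε
    refine ⟨G, hG, ?_⟩
    have := hDreg n m G s hs
    rwa [hs0] at this
  · intro F hF
    simp only [mem_iInter] at hF
    refine ⟨⋂ n, ⋂ m, {x | (F, x) ∈ D n m}, ?_, ?_⟩
    · simp only [countable_iInter_mem]
      intro n m
      refine residual_of_dense_open ((hDo n m).preimage (by fun_prop : Continuous fun x : C => (F, x))) ?_
      refine hq.mono ?_
      rintro _ ⟨i, rfl⟩
      exact hF i n m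
    · intro x₀ hx
      simp only [mem_iInter] at hx
      have hsub : ∀ n, ∀ u ∈ reachS F x₀ n, ∀ v ∈ reachS F x₀ n, u = v := by
        intro n u hu v hv
        rw [← dist_le_zero]
        refine le_of_forall_pos_lt_add fun ε hε => ?_
        obtain ⟨m, hm⟩ := exists_nat_one_div_lt (half_pos hε)
        obtain ⟨z, hz⟩ := mem_iUnion.1 (hx n m)
        have hz' := interior_subset hz
        have h1 := hz' u hu
        have h2 := hz' v hv
        have h3 := dist_triangle_right u v z
        linarith
      choose f hf using fun y : C => proj_nonempty (F.1 y) (y : X)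
      let g : C → C := fun y => ⟨f y, F.2.1 y (hf y).1⟩
      let x : ℕ → C := fun n => g^[n] x₀
      have hx1 : ∀ n, x (n + 1) = g (x n) := fun n => Function.iterate_succ_apply' g n x₀
      have hxr : ∀ n, x n ∈ reachS F x₀ n := by
        intro n
        induction n with
        | zero => exact rfl
        | succ n ih => exact ⟨x n, ih, by rw [hx1]; exact hf (x n)⟩
      refine ⟨x, rfl, fun k => ?_⟩
      ext w
      rw [mem_singleton_iff]
      constructor
      · intro hw
        have := hsub (k + 1) ⟨w, F.2.1 _ hw.1⟩ ⟨x k, hxr k, hw⟩ _ (hxr (k + 1))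
        exact congrArg Subtype.val this
      · rintro rfl
        rw [hx1]; exact hf (x k)
end
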